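/- arXiv:1008.3765 — 2 statements merged into one kernel-verified Lean document; each statement's English description precedes it below -/
import Mathlib

section
/- The error L_n of best uniform approximation of sgn(x) on I = [-A,-1] ∪ [1,B] by real polynomials of degree at most n satisfies lim_{n→∞} (ln(1/L_n))/n = η. -/
open MeasureTheory Filter Set Real

/-- sign function: -1 for negative, 1 otherwise (only used on sets avoiding 0) -/
noncomputable def sgn (x : ℝ) : ℝ := if x < 0 then -1 else 1

/-- The error of best uniform approximation of sgn on [-A,-1] ∪ [1,B]
by real polynomials of degree at most n. -/
noncomputable def bestErr (A B : ℝ) (n : ℕ) : ℝ :=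
  sInf {e : ℝ | ∃ p : Polynomial ℝ, p.degree ≤ (n : ℕ) ∧
    e = sSup ((fun x => |sgn x - p.eval x|) '' (Icc (-A) (-1) ∪ Icc 1 B))}

/-- the weight w(x) = ((1−x²)(x+A)(B−x))^(−1/2) -/
noncomputable def wt (A B x : ℝ) : ℝ := 1 / Real.sqrt ((1 - x ^ 2) * (x + A) * (B - x))

/-- the critical point C of the Green function -/
noncomputable def Ccrit (A B : ℝ) : ℝ :=
  (∫ x in (-1 : ℝ)..1, x * wt A B x) / (∫ x in (-1 : ℝ)..1, wt A B x)

/-- η = G(C,∞), the critical value of the Green function -/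
noncomputable def eta (A B : ℝ) : ℝ :=
  ∫ x in (-1 : ℝ)..(Ccrit A B), (Ccrit A B - x) * wt A B x




lemma aux_hardy (F : ℂ → ℂ) (S : Set ℝ) (hS : S.Countable) (D : ℝ → ℝ)
    (hd : ∀ z : ℂ, 0 < z.im → DifferentiableAt ℂ F z)
    (hc : ∀ t : ℝ, t ∉ S → Tendsto (fun y : ℝ => F (t + y * Complex.I)) (nhdsWithin 0 (Ioi 0)) (nhds (F t)))
    (hD : ∀ T : ℝ, IntervalIntegrable D volume (-T) T)
    (hb : ∀ t : ℝ, t ∉ S → ∀ y : ℝ, 0 < y → y < 1 → ‖F (t + y * Complex.I)‖ ≤ D t)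
    (hinf : ∀ ε : ℝ, 0 < ε → ∃ T0 : ℝ, ∀ z : ℂ, 0 < z.im → T0 ≤ ‖z‖ → ‖z‖ * ‖F z‖ ≤ ε) :
    Tendsto (fun T : ℝ => ∫ t in (-T)..T, F t) atTop (nhds 0) := by
  rw [Metric.tendsto_atTop]
  intro ε hε
  obtain ⟨T0, hT0⟩ := hinf (ε/8) (by positivity)
  refine ⟨max T0 1, fun T hT => ?_⟩
  have hT1 : 1 ≤ T := (le_max_right _ _).trans hT
  have hT2 : T0 ≤ T := (le_max_left _ _).trans hT
  have hTpos : 0 < T := by linarith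
  -- bound on each small height
  have hsmall : ∀ z : ℂ, 0 < z.im → T ≤ ‖z‖ → ‖F z‖ ≤ ε / 8 / T := by
    intro z hz hzT
    have h1 := hT0 z hz (hT2.trans hzT)
    rw [le_div_iff₀ hTpos]
    calc ‖F z‖ * T ≤ ‖F z‖ * ‖z‖ := by gcongr
      _ ≤ ε / 8 := by rw [mul_comm]; exact h1
  have key : ∀ y : ℝ, 0 < y → y < 1 → ‖∫ t in (-T)..T, F (t + y * Complex.I)‖ ≤ ε / 2 := by
    intro y hy0 hy1
    have hrect := Complex.integral_boundary_rect_eq_zero_of_differentiableOn F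
      (⟨-T, y⟩ : ℂ) (⟨T, T⟩ : ℂ) (by
        intro z hz
        apply (hd z _).differentiableWithinAt
        have := hz.2
        simp only [mem_preimage] at this
        rw [uIcc_of_le (by linarith)] at this
        exact lt_of_lt_of_le hy0 this.1)
    simp only [smul_eq_mul] at hrect
    have e1 : ‖∫ x in (-T)..T, F (x + (T:ℝ) * Complex.I)‖ ≤ ε/8/T * |T - (-T)| := by
      apply intervalIntegral.norm_integral_le_of_norm_le_const
      intro x hx
      apply hsmall
      · simp [hTpos]
      · calc T = |((x:ℂ) + (T:ℝ) * Complex.I).im| := by simp [abs_of_pos hTpos]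
          _ ≤ _ := Complex.abs_im_le_norm _
    have e2 : ‖∫ s in y..T, F ((T:ℝ) + (s:ℝ) * Complex.I)‖ ≤ ε/8/T * |T - y| := by
      apply intervalIntegral.norm_integral_le_of_norm_le_const
      intro x hx
      rw [uIoc_of_le (by linarith)] at hx
      apply hsmall
      · simp; linarith [hx.1]
      · calc T = |((T:ℂ) + (x:ℝ) * Complex.I).re| := by simp [abs_of_pos hTpos]
          _ ≤ _ := Complex.abs_re_le_norm _
    have e3 : ‖∫ s in y..T, F (((-T:ℝ):ℂ) + (s:ℝ) * Complex.I)‖ ≤ ε/8/T * |T - y| := by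
      apply intervalIntegral.norm_integral_le_of_norm_le_const
      intro x hx
      rw [uIoc_of_le (by linarith)] at hx
      apply hsmall
      · simp; linarith [hx.1]
      · calc T = |(((-T:ℝ):ℂ) + (x:ℝ) * Complex.I).re| := by simp [abs_of_pos hTpos]
          _ ≤ _ := Complex.abs_re_le_norm _
    have heq : (∫ t in (-T)..T, F (t + y * Complex.I)) = (∫ x in (-T)..T, F (x + (T:ℝ) * Complex.I))
        - Complex.I * (∫ s in y..T, F ((T:ℝ) + (s:ℝ) * Complex.I))
        + Complex.I * (∫ s in y..T, F (((-T:ℝ):ℂ) + (s:ℝ) * Complex.I)) := by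
      linear_combination hrect
    rw [heq]
    have hTy : |T - y| ≤ T := by rw [abs_of_nonneg (by linarith)]; linarith
    have hTT : |T - (-T)| = 2 * T := by rw [abs_of_nonneg (by linarith)]; ring
    have hc0 : 0 ≤ ε/8/T := by positivity
    have hcT : ε/8/T * T = ε/8 := by field_simp
    calc _ ≤ ‖(∫ x in (-T)..T, F (x + (T:ℝ) * Complex.I))‖
        + ‖Complex.I * (∫ s in y..T, F ((T:ℝ) + (s:ℝ) * Complex.I))‖
        + ‖Complex.I * (∫ s in y..T, F (((-T:ℝ):ℂ) + (s:ℝ) * Complex.I))‖ :=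
          (norm_add_le _ _).trans (by gcongr; exact norm_sub_le _ _)
      _ ≤ ε/8/T * (2*T) + ε/8/T * T + ε/8/T*T := by
          rw [norm_mul, norm_mul, Complex.norm_I, one_mul, one_mul]
          rw [hTT] at e1
          gcongr
          · exact e2.trans (by gcongr)
          · exact e3.trans (by gcongr)
      _ = ε/2 := by linear_combination 4 * hcT
  have hlim : Tendsto (fun y : ℝ => ∫ t in (-T)..T, F (t + y * Complex.I)) (nhdsWithin 0 (Ioi 0))
      (nhds (∫ t in (-T)..T, F t)) := by
    have hSae : ∀ᵐ t ∂(volume : Measure ℝ), t ∉ S := hS.ae_notMem _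
    have hyev : ∀ᶠ y in nhdsWithin (0:ℝ) (Ioi 0), 0 < y ∧ y < 1 := by
      have : Ioo (0:ℝ) 1 ∈ nhdsWithin (0:ℝ) (Ioi 0) := Ioo_mem_nhdsGT one_pos
      filter_upwards [this] with y hy using hy
    apply intervalIntegral.tendsto_integral_filter_of_dominated_convergence D
    · filter_upwards [hyev] with y hy
      apply Continuous.aestronglyMeasurable
      rw [continuous_iff_continuousAt]
      intro t
      have h1 : ContinuousAt F ((t:ℂ) + y * Complex.I) := (hd _ (by simp [hy.1])).continuousAt
      exact ContinuousAt.comp (f := fun t : ℝ => (t:ℂ) + y * Complex.I) h1 (by fun_prop)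
    · filter_upwards [hyev] with y hy
      filter_upwards [hSae] with t ht _
      exact hb t ht y hy.1 hy.2
    · exact hD T
    · filter_upwards [hSae] with t ht _
      exact hc t ht
  have hfin : ‖∫ t in (-T)..T, F t‖ ≤ ε/2 := by
    apply le_of_tendsto hlim.norm
    have : Ioo (0:ℝ) 1 ∈ nhdsWithin (0:ℝ) (Ioi 0) := Ioo_mem_nhdsGT one_pos
    filter_upwards [this] with y hy using key y hy.1 hy.2
  rw [dist_zero_right]
  linarith



noncomputable def rt (w : ℂ) : ℂ := w ^ ((1/2 : ℝ) : ℂ)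

lemma norm_rt (w : ℂ) : ‖rt w‖ = ‖w‖ ^ (1/2 : ℝ) := by
  unfold rt; rw [Complex.norm_cpow_real]

lemma rt_of_nonneg {x : ℝ} (hx : 0 ≤ x) : rt x = (√x : ℝ) := by
  unfold rt; rw [← Complex.ofReal_cpow hx, Real.sqrt_eq_rpow]

lemma rt_of_nonpos {x : ℝ} (hx : x ≤ 0) : rt x = Complex.I * (√(-x) : ℝ) := by
  unfold rt
  rw [Complex.ofReal_cpow_of_nonpos hx, ← Complex.ofReal_neg, ← Complex.ofReal_cpow (by linarith), Real.sqrt_eq_rpow, mul_comm]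
  congr 1
  rw [show (π:ℂ) * Complex.I * ((1/2:ℝ):ℂ) = π / 2 * Complex.I by push_cast; ring]
  exact Complex.exp_pi_div_two_mul_I

lemma rt_eq_exp {w : ℂ} (hw : w ≠ 0) : rt w = Complex.exp (Complex.log w / 2) := by
  unfold rt
  rw [Complex.cpow_def_of_ne_zero hw]; congr 1; push_cast; ring

lemma rt_ne_zero {w : ℂ} (hw : w ≠ 0) : rt w ≠ 0 := by
  rw [rt_eq_exp hw]; exact Complex.exp_ne_zero _

lemma slit_of_im_pos {w : ℂ} (hw : 0 < w.im) : w ∈ Complex.slitPlane :=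
  Or.inr hw.ne'

lemma log_tendsto_axis {s : ℝ} (hs : s ≠ 0) :
    Tendsto (fun y : ℝ => Complex.log (s + y * Complex.I)) (nhdsWithin 0 (Ioi 0)) (nhds (Complex.log s)) := by
  have h0 : Tendsto (fun y : ℝ => (s:ℂ) + y * Complex.I) (nhdsWithin 0 (Ioi 0)) (nhds (s:ℂ)) := by
    have : ContinuousAt (fun y : ℝ => (s:ℂ) + y * Complex.I) 0 := by fun_prop
    have h2 := this.tendsto.mono_left (nhdsWithin_le_nhds (s := Ioi 0))
    simpa using h2
  rcases lt_or_gt_of_ne hs with h | h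
  · have := Complex.continuousWithinAt_log_of_re_neg_of_im_zero (z := (s:ℂ)) (by simpa using h) (by simp)
    apply this.tendsto.comp
    rw [tendsto_nhdsWithin_iff]
    refine ⟨h0, ?_⟩
    filter_upwards [self_mem_nhdsWithin] with y hy
    simpa using (le_of_lt hy)
  · exact (continuousAt_clog (x := (s:ℂ)) (by simp [h])).tendsto.comp h0

lemma add_mul_I_ne_zero {s : ℝ} (hs : s ≠ 0) (y : ℝ) : (s:ℂ) + y * Complex.I ≠ 0 := by
  intro h
  have := congrArg Complex.re h
  simp at this
  exact hs this

lemma rt_tendsto_axis {s : ℝ} (hs : s ≠ 0) :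
    Tendsto (fun y : ℝ => rt (s + y * Complex.I)) (nhdsWithin 0 (Ioi 0)) (nhds (rt s)) := by
  rw [rt_eq_exp (by exact_mod_cast hs)]
  have h := (Complex.continuous_exp.tendsto _).comp ((log_tendsto_axis hs).div_const 2)
  refine h.congr' ?_
  filter_upwards with y
  simp only [Function.comp]
  rw [rt_eq_exp (add_mul_I_ne_zero hs y)]

lemma rt_diff {w : ℂ} (hw : 0 < w.im) : DifferentiableAt ℂ rt w := by
  unfold rt
  exact DifferentiableAt.cpow_const differentiableAt_id (slit_of_im_pos hw)

/-- neighbourhoods of infinity in the upper half plane -/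
noncomputable def upInf : Filter ℂ := comap (fun z : ℂ => ‖z‖) atTop ⊓ 𝓟 {z : ℂ | 0 < z.im}

lemma upInf_im : ∀ᶠ z in upInf, 0 < z.im := by
  unfold upInf
  exact eventually_inf_principal.2 (Eventually.of_forall fun z hz => hz)

lemma upInf_norm : Tendsto (fun z : ℂ => ‖z‖) upInf atTop :=
  (tendsto_comap).mono_left inf_le_left

lemma upInf_inv (c : ℂ) : Tendsto (fun z : ℂ => c / z) upInf (nhds 0) := by
  rw [tendsto_zero_iff_norm_tendsto_zero]
  simp only [norm_div]
  exact upInf_norm.const_div_atTop _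

lemma upInf_eps {F : ℂ → ℂ} (h : Tendsto (fun z => z * F z) upInf (nhds 0)) :
    ∀ ε : ℝ, 0 < ε → ∃ T0 : ℝ, ∀ z : ℂ, 0 < z.im → T0 ≤ ‖z‖ → ‖z‖ * ‖F z‖ ≤ ε := by
  intro ε hε
  have h1 := (Metric.tendsto_nhds.1 h) ε hε
  unfold upInf at h1
  rw [eventually_inf_principal, eventually_comap] at h1
  obtain ⟨T0, hT0⟩ := eventually_atTop.1 h1
  refine ⟨T0, fun z hz hzT => ?_⟩
  have := hT0 ‖z‖ hzT z rfl hz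
  rw [dist_zero_right, norm_mul] at this
  exact this.le

lemma log_sub_log {z : ℂ} (hz : 0 < z.im) (x : ℝ) :
    Complex.log (z - x) - Complex.log z = Complex.log (1 + (-(x:ℂ) / z)) := by
  have hz0 : z ≠ 0 := by rintro rfl; simp at hz
  have him : 0 < (z - x).im := by simpa using hz
  have hzx : z - x ≠ 0 := by intro h; rw [h] at him; simp at him
  have e : Complex.exp (Complex.log (z - x) - Complex.log z) = 1 + (-(x:ℂ) / z) := by
    rw [Complex.exp_sub, Complex.exp_log hz0, Complex.exp_log hzx]
    field_simp; ring
  rw [← e, Complex.log_exp]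
  · have h1 := Complex.arg_lt_pi_iff.2 (Or.inr hz.ne')
    have h2 := (Complex.arg_nonneg_iff (z := z - x)).2 him.le
    simp only [Complex.sub_im, Complex.log_im]
    linarith
  · have h1 := Complex.arg_le_pi (z - x)
    have h2 := (Complex.arg_nonneg_iff (z := z)).2 hz.le
    simp only [Complex.sub_im, Complex.log_im]
    linarith

lemma log_sub_log_tendsto (x : ℝ) :
    Tendsto (fun z : ℂ => Complex.log (z - x) - Complex.log z) upInf (nhds 0) := by
  have h1 : Tendsto (fun z : ℂ => Complex.log (1 + (-(x:ℂ) / z))) upInf (nhds 0) := by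
    have h2 : Tendsto (fun z : ℂ => 1 + (-(x:ℂ) / z)) upInf (nhds 1) := by
      simpa using (upInf_inv (-(x:ℂ))).const_add 1
    have h3 := (continuousAt_clog (x := (1:ℂ)) (by simp)).tendsto.comp h2
    simpa [Function.comp_def] using h3
  refine h1.congr' ?_
  filter_upwards [upInf_im] with z hz
  rw [log_sub_log hz]

/-- derivative of the complexified Green function, in the closed upper half plane -/
noncomputable def hfn (A B C : ℝ) (z : ℂ) : ℂ :=
  (z - C) / (rt (z - (-A : ℝ)) * rt (z - (-1 : ℝ)) * rt (z - (1 : ℝ)) * rt (z - B))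

lemma sub_ne_of_im {z : ℂ} (hz : 0 < z.im) (x : ℝ) : z - x ≠ 0 := by
  intro h
  have := congrArg Complex.im h
  simp at this
  linarith

lemma hfn_tendsto (A B C : ℝ) : Tendsto (fun z => z * hfn A B C z) upInf (nhds 1) := by
  have h1 : Tendsto (fun z : ℂ => (1 - C / z) * Complex.exp (-(((Complex.log (z - (-A:ℝ)) - Complex.log z) + (Complex.log (z - (-1:ℝ)) - Complex.log z)
    + (Complex.log (z - (1:ℝ)) - Complex.log z) + (Complex.log (z - B) - Complex.log z)) / 2))) upInf (nhds 1) := by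
    have a := ((((log_sub_log_tendsto (-A)).add (log_sub_log_tendsto (-1))).add (log_sub_log_tendsto 1)).add (log_sub_log_tendsto B)).div_const 2
    have b := (Complex.continuous_exp.tendsto _).comp a.neg
    have c := ((upInf_inv C).const_sub 1).mul b
    simpa [Function.comp_def] using c
  refine h1.congr' ?_
  filter_upwards [upInf_im] with z hz
  have hz0 : z ≠ 0 := by rintro rfl; simp at hz
  unfold hfn
  rw [rt_eq_exp (sub_ne_of_im hz _), rt_eq_exp (sub_ne_of_im hz _), rt_eq_exp (sub_ne_of_im hz _), rt_eq_exp (sub_ne_of_im hz _)]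
  have e : -(((Complex.log (z - (-A:ℝ)) - Complex.log z) + (Complex.log (z - (-1:ℝ)) - Complex.log z)
    + (Complex.log (z - (1:ℝ)) - Complex.log z) + (Complex.log (z - B) - Complex.log z)) / 2)
    = Complex.log z + Complex.log z - (Complex.log (z - (-A:ℝ)) / 2 + Complex.log (z - (-1:ℝ)) / 2 + Complex.log (z - (1:ℝ)) / 2 + Complex.log (z - B) / 2) := by ring
  rw [e, Complex.exp_sub, Complex.exp_add, Complex.exp_log hz0, Complex.exp_add, Complex.exp_add, Complex.exp_add]
  have n1 := Complex.exp_ne_zero (Complex.log (z - (-A:ℝ)) / 2)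
  have n2 := Complex.exp_ne_zero (Complex.log (z - (-1:ℝ)) / 2)
  have n3 := Complex.exp_ne_zero (Complex.log (z - (1:ℝ)) / 2)
  have n4 := Complex.exp_ne_zero (Complex.log (z - B) / 2)
  field_simp

lemma hfn_diff (A B C : ℝ) {z : ℂ} (hz : 0 < z.im) : DifferentiableAt ℂ (hfn A B C) z := by
  have key : ∀ x : ℝ, DifferentiableAt ℂ (fun z : ℂ => rt (z - x)) z := by
    intro x
    exact DifferentiableAt.comp (g := rt) (f := fun z : ℂ => z - x) z (rt_diff (by simpa using hz)) (by fun_prop)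
  unfold hfn
  apply DifferentiableAt.div (by fun_prop) ((((key _).mul (key _)).mul (key _)).mul (key _))
  exact mul_ne_zero (mul_ne_zero (mul_ne_zero (rt_ne_zero (sub_ne_of_im hz _)) (rt_ne_zero (sub_ne_of_im hz _))) (rt_ne_zero (sub_ne_of_im hz _))) (rt_ne_zero (sub_ne_of_im hz _))

lemma rt_sub_tendsto {t x : ℝ} (h : t ≠ x) :
    Tendsto (fun y : ℝ => rt (t + y * Complex.I - x)) (nhdsWithin 0 (Ioi 0)) (nhds (rt (t - x))) := by
  have := rt_tendsto_axis (s := t - x) (sub_ne_zero.2 h)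
  push_cast at this
  refine this.congr fun y => ?_
  congr 1; ring

lemma log_sub_tendsto {t x : ℝ} (h : t ≠ x) :
    Tendsto (fun y : ℝ => Complex.log (t + y * Complex.I - x)) (nhdsWithin 0 (Ioi 0)) (nhds (Complex.log (t - x))) := by
  have := log_tendsto_axis (s := t - x) (sub_ne_zero.2 h)
  push_cast at this
  refine this.congr fun y => ?_
  congr 1; ring

lemma hfn_tendsto_axis (A B C : ℝ) {t : ℝ} (h1 : t ≠ -A) (h2 : t ≠ -1) (h3 : t ≠ 1) (h4 : t ≠ B) :
    Tendsto (fun y : ℝ => hfn A B C (t + y * Complex.I)) (nhdsWithin 0 (Ioi 0)) (nhds (hfn A B C t)) := by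
  unfold hfn
  have ne : ∀ {x : ℝ}, t ≠ x → rt ((t:ℂ) - x) ≠ 0 := fun {x} h =>
    rt_ne_zero (sub_ne_zero.2 (by exact_mod_cast h))
  apply Tendsto.div
  · have : ContinuousAt (fun y : ℝ => (t:ℂ) + y * Complex.I - C) 0 := by fun_prop
    simpa using this.tendsto.mono_left (nhdsWithin_le_nhds (s := Ioi 0))
  · exact (((rt_sub_tendsto h1).mul (rt_sub_tendsto h2)).mul (rt_sub_tendsto h3)).mul (rt_sub_tendsto h4)
  · exact mul_ne_zero (mul_ne_zero (mul_ne_zero (ne h1) (ne h2)) (ne h3)) (ne h4)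

/-! domination -/

lemma pair_bound {p q : ℝ} (hpq : p ≠ q) : ∃ K : ℝ, 0 ≤ K ∧ ∀ t : ℝ, t ≠ p → t ≠ q →
    |t-p|^(-(1/2):ℝ) * |t-q|^(-(1/2):ℝ) ≤ K * (|t-p|^(-(1/2):ℝ) + |t-q|^(-(1/2):ℝ)) := by
  refine ⟨(√|p-q|)⁻¹, by positivity, fun t h1 h2 => ?_⟩
  have ha : 0 < |t-p| := abs_pos.2 (sub_ne_zero.2 h1)
  have hb : 0 < |t-q| := abs_pos.2 (sub_ne_zero.2 h2)
  have hs : 0 < |p-q| := abs_pos.2 (sub_ne_zero.2 hpq)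
  have hab : |p-q| ≤ |t-p| + |t-q| := by
    have := abs_sub_le p t q
    rwa [abs_sub_comm p t] at this
  rw [Real.rpow_neg ha.le, Real.rpow_neg hb.le, ← Real.sqrt_eq_rpow, ← Real.sqrt_eq_rpow]
  have h3 : √|p-q| ≤ √|t-p| + √|t-q| := by
    apply Real.sqrt_le_iff.2
    refine ⟨by positivity, ?_⟩
    nlinarith [Real.sq_sqrt ha.le, Real.sq_sqrt hb.le, mul_pos (Real.sqrt_pos.2 ha) (Real.sqrt_pos.2 hb)]
  have sa := Real.sqrt_pos.2 ha
  have sb := Real.sqrt_pos.2 hb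
  have ss := Real.sqrt_pos.2 hs
  rw [show (√|t-p|)⁻¹ + (√|t-q|)⁻¹ = (√|t-p| + √|t-q|) * ((√|t-p|)⁻¹ * (√|t-q|)⁻¹) by field_simp; ring, ← mul_assoc]
  have : 1 ≤ (√|p-q|)⁻¹ * (√|t-p| + √|t-q|) := by
    rw [inv_mul_eq_div, one_le_div ss]; exact h3
  have h4 : 0 ≤ (√|t-p|)⁻¹ * (√|t-q|)⁻¹ := by positivity
  nlinarith

lemma four_bound {a b c d : ℝ} (hab : a < b) (hbc : b < c) (hcd : c < d) : ∃ K : ℝ, 0 ≤ K ∧ ∀ t : ℝ,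
    t ≠ a → t ≠ b → t ≠ c → t ≠ d →
    |t-a|^(-(1/2):ℝ) * |t-b|^(-(1/2):ℝ) * |t-c|^(-(1/2):ℝ) * |t-d|^(-(1/2):ℝ)
      ≤ K * (|t-a|^(-(1/2):ℝ) + |t-b|^(-(1/2):ℝ) + |t-c|^(-(1/2):ℝ) + |t-d|^(-(1/2):ℝ)) := by
  obtain ⟨k1, hk1, H1⟩ := pair_bound (p := a) (q := b) (by linarith)
  obtain ⟨k2, hk2, H2⟩ := pair_bound (p := c) (q := d) (by linarith)
  obtain ⟨k3, hk3, H3⟩ := pair_bound (p := a) (q := c) (by linarith)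
  obtain ⟨k4, hk4, H4⟩ := pair_bound (p := a) (q := d) (by linarith)
  obtain ⟨k5, hk5, H5⟩ := pair_bound (p := b) (q := c) (by linarith)
  obtain ⟨k6, hk6, H6⟩ := pair_bound (p := b) (q := d) (by linarith)
  refine ⟨k1 * k2 * (k3 + k4 + k5 + k6), by positivity, fun t ha hb hc hd => ?_⟩
  replace H1 := H1 t ha hb
  replace H2 := H2 t hc hd
  replace H3 := H3 t ha hc
  replace H4 := H4 t ha hd
  replace H5 := H5 t hb hc
  replace H6 := H6 t hb hd
  have pa : 0 ≤ |t-a|^(-(1/2):ℝ) := by positivity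
  have pb : 0 ≤ |t-b|^(-(1/2):ℝ) := by positivity
  have pc : 0 ≤ |t-c|^(-(1/2):ℝ) := by positivity
  have pd : 0 ≤ |t-d|^(-(1/2):ℝ) := by positivity
  generalize |t-a|^(-(1/2):ℝ) = fa at *
  generalize |t-b|^(-(1/2):ℝ) = fb at *
  generalize |t-c|^(-(1/2):ℝ) = fc at *
  generalize |t-d|^(-(1/2):ℝ) = fd at *
  calc fa * fb * fc * fd = (fa * fb) * (fc * fd) := by ring
    _ ≤ (k1 * (fa + fb)) * (k2 * (fc + fd)) := by gcongr
    _ = k1 * k2 * (fa * fc + fa * fd + fb * fc + fb * fd) := by ring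
    _ ≤ k1 * k2 * (k3 * (fa + fc) + k4 * (fa + fd) + k5 * (fb + fc) + k6 * (fb + fd)) := by gcongr
    _ ≤ k1 * k2 * (k3 * (fa + fb + fc + fd) + k4 * (fa + fb + fc + fd) + k5 * (fa + fb + fc + fd) + k6 * (fa + fb + fc + fd)) := by
        obtain ⟨S, hS⟩ : ∃ S, S = fa + fb + fc + fd := ⟨_, rfl⟩
        rw [← hS]
        have s1 : fa + fc ≤ S := by linarith
        have s2 : fa + fd ≤ S := by linarith
        have s3 : fb + fc ≤ S := by linarith
        have s4 : fb + fd ≤ S := by linarith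
        gcongr
    _ = _ := by ring

lemma ii_abs_rpow (r : ℝ) (hr : -1 < r) (p a b : ℝ) : IntervalIntegrable (fun t : ℝ => |t - p| ^ r) volume a b := by
  have key : ∀ c : ℝ, 0 ≤ c → IntervalIntegrable (fun t : ℝ => |t| ^ r) volume 0 c := by
    intro c hc
    apply (intervalIntegral.intervalIntegrable_rpow' (a := 0) (b := c) hr).congr
    intro x hx
    rw [uIoc_of_le hc] at hx
    simp [abs_of_pos hx.1]
  have key2 : ∀ c : ℝ, IntervalIntegrable (fun t : ℝ => |t| ^ r) volume 0 c := by
    intro c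
    rcases le_total 0 c with h | h
    · exact key c h
    · have := (IntervalIntegrable.iff_comp_neg (f := fun t : ℝ => |t| ^ r) (a := 0) (b := c) ).2
      apply this
      simpa using key (-c) (by linarith)
  have := ((key2 (a - p)).symm.trans (key2 (b - p))).comp_sub_right p
  simpa using this

lemma young_rpow (u v : ℝ) (hu : 0 < u) (hv : 0 < v) :
    u^(-(1/2):ℝ) * v^(-(1/4):ℝ) ≤ u^(-(3/4):ℝ) + v^(-(3/4):ℝ) := by
  rcases le_total u v with h | h
  · have : v^(-(1/4):ℝ) ≤ u^(-(1/4):ℝ) := Real.rpow_le_rpow_of_nonpos hu h (by norm_num)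
    have h2 : u^(-(3/4):ℝ) = u^(-(1/2):ℝ) * u^(-(1/4):ℝ) := by rw [← Real.rpow_add hu]; norm_num
    have : u^(-(1/2):ℝ) * v^(-(1/4):ℝ) ≤ u^(-(3/4):ℝ) := by rw [h2]; gcongr
    have : 0 ≤ v^(-(3/4):ℝ) := by positivity
    linarith
  · have : u^(-(1/2):ℝ) ≤ v^(-(1/2):ℝ) := Real.rpow_le_rpow_of_nonpos hv h (by norm_num)
    have h2 : v^(-(3/4):ℝ) = v^(-(1/2):ℝ) * v^(-(1/4):ℝ) := by rw [← Real.rpow_add hv]; norm_num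
    have : u^(-(1/2):ℝ) * v^(-(1/4):ℝ) ≤ v^(-(3/4):ℝ) := by rw [h2]; gcongr
    have : 0 ≤ u^(-(3/4):ℝ) := by positivity
    linarith

lemma ii_prod (p q a b : ℝ) : IntervalIntegrable (fun t : ℝ => |t - p| ^ (-(1/2):ℝ) * |t-q|^(-(1/4):ℝ)) volume a b := by
  have h := (ii_abs_rpow (-(3/4)) (by norm_num) p a b).add (ii_abs_rpow (-(3/4)) (by norm_num) q a b)
  apply h.mono_fun
  · apply Measurable.aestronglyMeasurable
    fun_prop
  · have hae : ∀ᵐ t ∂(volume.restrict (uIoc a b)), t ∉ ({p, q} : Set ℝ) :=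
      ae_restrict_of_ae ((Set.Finite.countable (by simp)).ae_notMem _)
    filter_upwards [hae] with t ht
    simp only [mem_insert_iff, mem_singleton_iff, not_or] at ht
    have := young_rpow |t-p| |t-q| (abs_pos.2 (sub_ne_zero.2 ht.1)) (abs_pos.2 (sub_ne_zero.2 ht.2))
    rw [Real.norm_of_nonneg (by positivity), Real.norm_of_nonneg (by positivity)]
    exact this



lemma hfn_real (A B C t : ℝ) : hfn A B C t =
    ((t - C : ℝ) : ℂ) / (rt ((t + A : ℝ) : ℂ) * rt ((t + 1 : ℝ) : ℂ) * rt ((t - 1 : ℝ) : ℂ) * rt ((t - B : ℝ) : ℂ)) := by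
  unfold hfn; push_cast; simp only [sub_neg_eq_add]

lemma hfn_gap {A B C t : ℝ} (hA : 1 < A) (hB : 1 < B) (h1 : -1 ≤ t) (h2 : t ≤ 1) :
    hfn A B C t = (((C - t) / (√(t + A) * √(t + 1) * √(-(t - 1)) * √(-(t - B))) : ℝ) : ℂ) := by
  rw [hfn_real, rt_of_nonneg (by linarith), rt_of_nonneg (by linarith), rt_of_nonpos (by linarith), rt_of_nonpos (by linarith)]
  push_cast
  simp only [div_eq_mul_inv, mul_inv, Complex.inv_I]
  ring_nf
  simp only [Complex.I_sq]; ring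

lemma hfn_right {A B C t : ℝ} (hA : 1 < A) (h1 : 1 ≤ t) (h2 : t ≤ B) :
    hfn A B C t = Complex.I * ((-((t - C) / (√(t + A) * √(t + 1) * √(t - 1) * √(-(t - B)))) : ℝ) : ℂ) := by
  rw [hfn_real, rt_of_nonneg (by linarith), rt_of_nonneg (by linarith), rt_of_nonneg (by linarith), rt_of_nonpos (by linarith)]
  push_cast
  simp only [div_eq_mul_inv, mul_inv, Complex.inv_I]
  ring_nf

lemma hfn_left {A B C t : ℝ} (hB : 1 < B) (h1 : -A ≤ t) (h2 : t ≤ -1) :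
    hfn A B C t = Complex.I * ((((t - C) / (√(t + A) * √(-(t + 1)) * √(-(t - 1)) * √(-(t - B)))) : ℝ) : ℂ) := by
  rw [hfn_real, rt_of_nonneg (by linarith), rt_of_nonpos (by linarith), rt_of_nonpos (by linarith), rt_of_nonpos (by linarith)]
  push_cast
  simp only [div_eq_mul_inv, mul_inv, Complex.inv_I]
  ring_nf
  simp only [Complex.I_pow_three]; ring

lemma hfn_oright {A B C t : ℝ} (hA : 1 < A) (hB : 1 < B) (h2 : B ≤ t) :
    hfn A B C t = ((((t - C) / (√(t + A) * √(t + 1) * √(t - 1) * √(t - B))) : ℝ) : ℂ) := by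
  rw [hfn_real, rt_of_nonneg (by linarith), rt_of_nonneg (by linarith), rt_of_nonneg (by linarith), rt_of_nonneg (by linarith)]
  push_cast
  rfl

lemma hfn_oleft {A B C t : ℝ} (hA : 1 < A) (hB : 1 < B) (h2 : t ≤ -A) :
    hfn A B C t = ((((t - C) / (√(-(t + A)) * √(-(t + 1)) * √(-(t - 1)) * √(-(t - B)))) : ℝ) : ℂ) := by
  rw [hfn_real, rt_of_nonpos (by linarith), rt_of_nonpos (by linarith), rt_of_nonpos (by linarith), rt_of_nonpos (by linarith)]
  push_cast
  simp only [div_eq_mul_inv, mul_inv, Complex.inv_I]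
  ring_nf
  simp only [Complex.I_pow_four]; ring

lemma rt_meas : Measurable rt := by unfold rt; fun_prop

lemma hfn_meas (A B C : ℝ) : Measurable (fun t : ℝ => hfn A B C t) := by
  unfold hfn
  have := rt_meas
  fun_prop

/-- the dominating weight -/
noncomputable def dW (A B C K t : ℝ) : ℝ := (|t - C| + 1) * (K * (|t-(-A)|^(-(1/2):ℝ) + |t-(-1)|^(-(1/2):ℝ) + |t-1|^(-(1/2):ℝ) + |t-B|^(-(1/2):ℝ)))

lemma inv_rt_le {t x : ℝ} (h : t ≠ x) (y : ℝ) : ‖(rt (t + y * Complex.I - x))⁻¹‖ ≤ |t - x|^(-(1/2):ℝ) := by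
  have h0 : 0 < |t - x| := abs_pos.2 (sub_ne_zero.2 h)
  have h1 : |t - x| ≤ ‖(t:ℂ) + y * Complex.I - x‖ := by
    have := Complex.abs_re_le_norm ((t:ℂ) + y * Complex.I - x)
    simpa using this
  rw [norm_inv, norm_rt, Real.rpow_neg h0.le]
  gcongr

lemma hfn_bound {A B : ℝ} (C : ℝ) (hA : 1 < A) (hB : 1 < B) : ∃ K : ℝ, 0 ≤ K ∧ ∀ t : ℝ, t ≠ -A → t ≠ -1 → t ≠ 1 → t ≠ B →
    ∀ y : ℝ, 0 ≤ y → y < 1 → ‖hfn A B C (t + y * Complex.I)‖ ≤ dW A B C K t := by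
  obtain ⟨K, hK, H⟩ := four_bound (a := -A) (b := -1) (c := 1) (d := B) (by linarith) (by linarith) hB
  refine ⟨K, hK, fun t h1 h2 h3 h4 y hy hy1 => ?_⟩
  unfold hfn dW
  rw [div_eq_mul_inv, norm_mul]
  gcongr
  · calc ‖(t:ℂ) + y * Complex.I - C‖ = ‖((t - C : ℝ) : ℂ) + y * Complex.I‖ := by push_cast; congr 1; ring
      _ ≤ ‖((t - C : ℝ) : ℂ)‖ + ‖y * Complex.I‖ := norm_add_le _ _
      _ ≤ |t - C| + 1 := by
        rw [Complex.norm_real, norm_mul, Complex.norm_I, Complex.norm_real, mul_one, Real.norm_eq_abs, Real.norm_eq_abs, abs_of_nonneg hy]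
        linarith
  · refine le_trans ?_ (H t h1 h2 h3 h4)
    rw [mul_inv, mul_inv, mul_inv, norm_mul, norm_mul, norm_mul]
    gcongr <;> exact inv_rt_le (by assumption) y

lemma dW_ii (A B C K a b : ℝ) : IntervalIntegrable (dW A B C K) volume a b := by
  unfold dW
  apply IntervalIntegrable.continuousOn_mul _ (by fun_prop)
  apply IntervalIntegrable.const_mul
  have h := fun p => ii_abs_rpow (-(1/2)) (by norm_num) p a b
  exact (((h _).add (h _)).add (h _)).add (h _)

lemma dW_ii2 (A B C K q a b : ℝ) : IntervalIntegrable (fun t => dW A B C K t * |t-q|^(-(1/4):ℝ)) volume a b := by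
  unfold dW
  have h := fun p => ii_prod p q a b
  have := ((((h (-A)).add (h (-1))).add (h 1)).add (h B)).const_mul K
  refine (this.continuousOn_mul (g := fun t => |t - C| + 1) (by fun_prop)).congr fun t ht => ?_
  ring

/-- dominating function for logarithms -/
noncomputable def dL (x t : ℝ) : ℝ := (|t - x| + 1) + 4 * |t-x|^(-(1/4):ℝ) + π

lemma dL_bound {t x : ℝ} (h : t ≠ x) {y : ℝ} (hy : 0 ≤ y) (hy1 : y < 1) :
    ‖Complex.log (t + y * Complex.I - x)‖ ≤ dL x t := by
  have h0 : 0 < |t - x| := abs_pos.2 (sub_ne_zero.2 h)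
  set w := (t:ℂ) + y * Complex.I - x with hw
  have h1 : |t - x| ≤ ‖w‖ := by
    have := Complex.abs_re_le_norm w
    simpa [hw] using this
  have h2 : ‖w‖ ≤ |t - x| + 1 := by
    calc ‖w‖ = ‖((t - x : ℝ) : ℂ) + y * Complex.I‖ := by rw [hw]; push_cast; congr 1; ring
      _ ≤ ‖((t - x : ℝ) : ℂ)‖ + ‖y * Complex.I‖ := norm_add_le _ _
      _ ≤ |t - x| + 1 := by
        rw [Complex.norm_real, norm_mul, Complex.norm_I, Complex.norm_real, mul_one, Real.norm_eq_abs, Real.norm_eq_abs, abs_of_nonneg hy]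
        linarith
  have h3 : ‖Complex.log w‖ ≤ |Real.log ‖w‖| + |Complex.arg w| := by
    have := Complex.norm_le_abs_re_add_abs_im (Complex.log w)
    simpa [Complex.log_re, Complex.log_im] using this
  have h4 : |Complex.arg w| ≤ π := Complex.abs_arg_le_pi w
  have hp : 0 ≤ |t-x|^(-(1/4):ℝ) := by positivity
  have h5 : |Real.log ‖w‖| ≤ (|t - x| + 1) + 4 * |t-x|^(-(1/4):ℝ) := by
    rw [abs_le]
    constructor
    · have a1 : Real.log |t-x| ≤ Real.log ‖w‖ := Real.log_le_log h0 h1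
      have a2 : Real.log (|t-x|^(-(1/4):ℝ)) ≤ |t-x|^(-(1/4):ℝ) := Real.log_le_self (by positivity)
      rw [Real.log_rpow h0] at a2
      linarith
    · have a1 : Real.log ‖w‖ ≤ ‖w‖ := Real.log_le_self (norm_nonneg _)
      linarith
  unfold dL; linarith

lemma dWL_ii (A B C K x a b : ℝ) : IntervalIntegrable (fun t => dW A B C K t * dL x t) volume a b := by
  have h1 := (dW_ii2 A B C K x a b).const_mul 4
  have h2 := (dW_ii A B C K a b).continuousOn_mul (g := fun t => |t - x| + 1 + π) (by fun_prop)
  refine (h1.add h2).congr fun t ht => ?_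
  simp only [dL]; ring

/-- the integrand of the logarithmic identity -/
noncomputable def Ffn (A B C x : ℝ) (z : ℂ) : ℂ := hfn A B C z * Complex.log (z - x)

lemma Ffn_meas (A B C x : ℝ) : Measurable (fun t : ℝ => Ffn A B C x t) := by
  unfold Ffn
  have := hfn_meas A B C
  fun_prop

lemma hfn_ii {A B : ℝ} (C : ℝ) (hA : 1 < A) (hB : 1 < B) (a b : ℝ) :
    IntervalIntegrable (fun t : ℝ => hfn A B C t) volume a b := by
  obtain ⟨K, hK, H⟩ := hfn_bound C hA hB
  apply (dW_ii A B C K a b).mono_fun (hfn_meas A B C).aestronglyMeasurable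
  have hae : ∀ᵐ t ∂(volume.restrict (uIoc a b)), t ∉ ({-A, -1, 1, B} : Set ℝ) :=
      ae_restrict_of_ae ((Set.Finite.countable (by simp)).ae_notMem _)
  filter_upwards [hae] with t ht
  simp only [mem_insert_iff, mem_singleton_iff, not_or] at ht
  have := H t ht.1 ht.2.1 ht.2.2.1 ht.2.2.2 0 le_rfl one_pos
  simp only [Complex.ofReal_zero, zero_mul, add_zero] at this
  exact this.trans (le_abs_self _)

lemma Ffn_bound {A B : ℝ} (C : ℝ) (hA : 1 < A) (hB : 1 < B) : ∃ K : ℝ, 0 ≤ K ∧ ∀ x t : ℝ,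
    t ≠ -A → t ≠ -1 → t ≠ 1 → t ≠ B → t ≠ x → 
    ∀ y : ℝ, 0 ≤ y → y < 1 → ‖Ffn A B C x (t + y * Complex.I)‖ ≤ dW A B C K t * dL x t := by
  obtain ⟨K, hK, H⟩ := hfn_bound C hA hB
  refine ⟨K, hK, fun x t h1 h2 h3 h4 h5 y hy hy1 => ?_⟩
  unfold Ffn
  rw [norm_mul]
  have := H t h1 h2 h3 h4 y hy hy1
  exact mul_le_mul this (dL_bound h5 hy hy1) (norm_nonneg _) ((norm_nonneg _).trans this)

lemma Ffn_ii {A B : ℝ} (C : ℝ) (hA : 1 < A) (hB : 1 < B) (x a b : ℝ) :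
    IntervalIntegrable (fun t : ℝ => Ffn A B C x t) volume a b := by
  obtain ⟨K, hK, H⟩ := Ffn_bound C hA hB
  apply (dWL_ii A B C K x a b).mono_fun (Ffn_meas A B C x).aestronglyMeasurable
  have hae : ∀ᵐ t ∂(volume.restrict (uIoc a b)), t ∉ ({-A, -1, 1, B, x} : Set ℝ) :=
      ae_restrict_of_ae ((Set.Finite.countable (by simp)).ae_notMem _)
  filter_upwards [hae] with t ht
  simp only [mem_insert_iff, mem_singleton_iff, not_or] at ht
  have := H x t ht.1 ht.2.1 ht.2.2.1 ht.2.2.2.1 ht.2.2.2.2 0 le_rfl one_pos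
  simp only [Complex.ofReal_zero, zero_mul, add_zero] at this
  exact this.trans (le_abs_self _)

lemma log_identity {A B : ℝ} (C : ℝ) (hA : 1 < A) (hB : 1 < B) (x1 x2 : ℝ) :
    Tendsto (fun T : ℝ => ∫ t in (-T)..T, (Ffn A B C x1 t - Ffn A B C x2 t)) atTop (nhds 0) := by
  obtain ⟨K, hK, H⟩ := Ffn_bound C hA hB
  apply aux_hardy (fun z => Ffn A B C x1 z - Ffn A B C x2 z) ({-A, -1, 1, B, x1, x2} : Set ℝ)
    (Set.Finite.countable (by simp)) (fun t => dW A B C K t * dL x1 t + dW A B C K t * dL x2 t)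
  · intro z hz
    have hl : ∀ x : ℝ, DifferentiableAt ℂ (fun z : ℂ => Complex.log (z - x)) z := fun x =>
      DifferentiableAt.clog (by fun_prop) (slit_of_im_pos (by simpa using hz))
    unfold Ffn
    exact ((hfn_diff A B C hz).mul (hl x1)).sub ((hfn_diff A B C hz).mul (hl x2))
  · intro t ht
    simp only [mem_insert_iff, mem_singleton_iff, not_or] at ht
    have hh := hfn_tendsto_axis A B C ht.1 ht.2.1 ht.2.2.1 ht.2.2.2.1
    exact (hh.mul (log_sub_tendsto ht.2.2.2.2.1)).sub (hh.mul (log_sub_tendsto ht.2.2.2.2.2))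
  · intro T
    exact (dWL_ii A B C K x1 _ _).add (dWL_ii A B C K x2 _ _)
  · intro t ht y hy hy1
    simp only [mem_insert_iff, mem_singleton_iff, not_or] at ht
    refine (norm_sub_le _ _).trans (add_le_add ?_ ?_)
    · exact H x1 t ht.1 ht.2.1 ht.2.2.1 ht.2.2.2.1 ht.2.2.2.2.1 y hy.le hy1
    · exact H x2 t ht.1 ht.2.1 ht.2.2.1 ht.2.2.2.1 ht.2.2.2.2.2 y hy.le hy1
  · apply upInf_eps
    have := (hfn_tendsto A B C).mul ((log_sub_log_tendsto x1).sub (log_sub_log_tendsto x2))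
    simp only [sub_zero, mul_zero] at this
    refine this.congr fun z => ?_
    unfold Ffn; ring

lemma mass_identity {A B : ℝ} (C : ℝ) (hA : 1 < A) (hB : 1 < B) :
    Tendsto (fun T : ℝ => ∫ t in (-T)..T, (hfn A B C t - 1 / ((t:ℂ) + Complex.I))) atTop (nhds 0) := by
  obtain ⟨K, hK, H⟩ := hfn_bound C hA hB
  have hne : ∀ z : ℂ, 0 ≤ z.im → z + Complex.I ≠ 0 := by
    intro z hz h
    have := congrArg Complex.im h
    simp at this; linarith
  apply aux_hardy (fun z => hfn A B C z - 1 / (z + Complex.I)) ({-A, -1, 1, B} : Set ℝ)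
    (Set.Finite.countable (by simp)) (fun t => dW A B C K t + 1)
  · intro z hz
    exact (hfn_diff A B C hz).sub (DifferentiableAt.div (by fun_prop) (by fun_prop) (hne z hz.le))
  · intro t ht
    simp only [mem_insert_iff, mem_singleton_iff, not_or] at ht
    apply (hfn_tendsto_axis A B C ht.1 ht.2.1 ht.2.2.1 ht.2.2.2).sub
    have : ContinuousAt (fun y : ℝ => 1 / ((t:ℂ) + y * Complex.I + Complex.I)) 0 := by
      apply ContinuousAt.div (by fun_prop) (by fun_prop)
      apply hne; simp
    simpa using this.tendsto.mono_left (nhdsWithin_le_nhds (s := Ioi 0))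
  · intro T
    exact (dW_ii A B C K _ _).add intervalIntegrable_const
  · intro t ht y hy hy1
    simp only [mem_insert_iff, mem_singleton_iff, not_or] at ht
    refine (norm_sub_le _ _).trans (add_le_add ?_ ?_)
    · exact H t ht.1 ht.2.1 ht.2.2.1 ht.2.2.2 y hy.le hy1
    · rw [norm_div, norm_one]
      apply div_le_one_of_le₀ _ (norm_nonneg _)
      have := Complex.abs_im_le_norm ((t:ℂ) + y * Complex.I + Complex.I)
      simp only [Complex.add_im, Complex.ofReal_im, Complex.mul_im, Complex.ofReal_re, Complex.I_im, mul_one, Complex.I_re, mul_zero, add_zero, zero_add] at this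
      exact le_trans (by rw [abs_of_pos (by linarith)]; linarith) this
  · apply upInf_eps
    have h2 : Tendsto (fun z : ℂ => 1 / (1 + Complex.I / z)) upInf (nhds 1) := by
      have := ((upInf_inv Complex.I).const_add 1)
      have h3 := this.inv₀ (by simp)
      simpa using h3
    have := (hfn_tendsto A B C).sub h2
    simp only [sub_self] at this
    refine this.congr' ?_
    filter_upwards [upInf_im] with z hz
    have hz0 : z ≠ 0 := by rintro rfl; simp at hz
    have := hne z hz.le
    rw [mul_sub]; congr 1
    field_simp



/-- the equilibrium density -/
noncomputable def rho (A B C t : ℝ) : ℝ := -(hfn A B C t).im / π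

/-- the logarithmic potential -/
noncomputable def Upot (A B C : ℝ) (z : ℂ) : ℝ := ∫ t : ℝ, rho A B C t * Real.log ‖z - t‖

lemma rho_zero {A B C t : ℝ} (hA : 1 < A) (hB : 1 < B) (ht : t ∉ Icc (-A) (-1) ∪ Icc 1 B) : rho A B C t = 0 := by
  have him : (hfn A B C t).im = 0 := by
    simp only [mem_union, mem_Icc, not_or, not_and, not_le] at ht
    rcases lt_or_ge t (-A) with h | h
    · rw [hfn_oleft hA hB h.le, Complex.ofReal_im]
    · have h1 := ht.1 h
      rcases lt_or_ge t 1 with h2 | h2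
      · rw [hfn_gap hA hB h1.le h2.le, Complex.ofReal_im]
      · rw [hfn_oright hA hB (ht.2 h2).le, Complex.ofReal_im]
  unfold rho; rw [him]; simp

lemma rho_nonneg {A B C : ℝ} (hA : 1 < A) (hB : 1 < B) (hC1 : -1 < C) (hC2 : C < 1) (t : ℝ) : 0 ≤ rho A B C t := by
  by_cases ht : t ∈ Icc (-A) (-1) ∪ Icc 1 B
  · unfold rho
    apply div_nonneg _ Real.pi_pos.le
    rcases ht with ht | ht
    · rw [hfn_left hB ht.1 ht.2, Complex.I_mul_im, Complex.ofReal_re]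
      rw [neg_nonneg]
      apply div_nonpos_of_nonpos_of_nonneg (by linarith [ht.2]) (by positivity)
    · rw [hfn_right hA ht.1 ht.2, Complex.I_mul_im, Complex.ofReal_re, neg_neg]
      apply div_nonneg (by linarith [ht.1]) (by positivity)
  · rw [rho_zero hA hB ht]

lemma re_left {A B C t : ℝ} (hB : 1 < B) (h1 : -A ≤ t) (h2 : t ≤ -1) : (hfn A B C t).re = 0 := by
  rw [hfn_left hB h1 h2, Complex.I_mul_re, Complex.ofReal_im, neg_zero]

lemma re_right {A B C t : ℝ} (hA : 1 < A) (h1 : 1 ≤ t) (h2 : t ≤ B) : (hfn A B C t).re = 0 := by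
  rw [hfn_right hA h1 h2, Complex.I_mul_re, Complex.ofReal_im, neg_zero]

lemma re_oright {A B C t : ℝ} (hA : 1 < A) (hB : 1 < B) (hC2 : C < 1) (h2 : B ≤ t) : 0 ≤ (hfn A B C t).re := by
  rw [hfn_oright hA hB h2, Complex.ofReal_re]
  apply div_nonneg (by linarith) (by positivity)

lemma re_oleft {A B C t : ℝ} (hA : 1 < A) (hB : 1 < B) (hC1 : -1 < C) (h2 : t ≤ -A) : (hfn A B C t).re ≤ 0 := by
  rw [hfn_oleft hA hB h2, Complex.ofReal_re]
  apply div_nonpos_of_nonpos_of_nonneg (by linarith) (by positivity)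

lemma supp_I {A B C : ℝ} (hA : 1 < A) (hB : 1 < B) (f : ℝ → ℝ) {T : ℝ} (hT : A + B < T) :
    Function.support (fun t => rho A B C t * f t) ⊆ Ioc (-T) T := by
  intro t ht
  by_contra h
  apply ht
  simp only
  rw [rho_zero hA hB, zero_mul]
  intro h2
  apply h
  rcases h2 with h2 | h2
  · exact ⟨by linarith [h2.1], by linarith [h2.2]⟩
  · exact ⟨by linarith [h2.1], by linarith [h2.2]⟩

lemma int_of_ii {A B C : ℝ} (hA : 1 < A) (hB : 1 < B) (f : ℝ → ℝ)
    (h : ∀ T, IntervalIntegrable (fun t => rho A B C t * f t) volume (-T) T) :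
    Integrable (fun t => rho A B C t * f t) := by
  have := h (A + B + 1)
  rw [intervalIntegrable_iff_integrableOn_Ioc_of_le (by linarith)] at this
  exact (integrableOn_iff_integrable_of_support_subset (supp_I hA hB f (by linarith))).1 this

lemma IntervalIntegrable.cim {f : ℝ → ℂ} {a b : ℝ} (h : IntervalIntegrable f volume a b) :
    IntervalIntegrable (fun t => (f t).im) volume a b :=
  ⟨h.1.im, h.2.im⟩

lemma IntervalIntegrable.cre {f : ℝ → ℂ} {a b : ℝ} (h : IntervalIntegrable f volume a b) :
    IntervalIntegrable (fun t => (f t).re) volume a b :=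
  ⟨h.1.re, h.2.re⟩

lemma int_im {f : ℝ → ℂ} {a b : ℝ} (h : IntervalIntegrable f volume a b) :
    (∫ t in a..b, f t).im = ∫ t in a..b, (f t).im := by
  have := Complex.imCLM.intervalIntegral_comp_comm h
  simpa using this.symm

lemma rho_ii {A B : ℝ} (C : ℝ) (hA : 1 < A) (hB : 1 < B) (a b : ℝ) :
    IntervalIntegrable (rho A B C) volume a b := by
  unfold rho
  exact ((hfn_ii C hA hB a b).cim.neg).div_const π

lemma rho_int {A B : ℝ} (C : ℝ) (hA : 1 < A) (hB : 1 < B) : Integrable (rho A B C) := by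
  have := int_of_ii (C := C) hA hB (fun _ => 1) (fun T => by simpa using rho_ii C hA hB (-T) T)
  simpa using this

lemma rho_log_ii {A B : ℝ} (C : ℝ) (hA : 1 < A) (hB : 1 < B) (x a b : ℝ) :
    IntervalIntegrable (fun t => rho A B C t * Real.log ‖(x:ℂ) - t‖) volume a b := by
  obtain ⟨K, hK, H⟩ := Ffn_bound C hA hB
  have hm : Measurable (rho A B C) := by
    have := hfn_meas A B C
    unfold rho; fun_prop
  have := (dWL_ii A B C K x a b).mono_fun (g := fun t => rho A B C t * Real.log ‖(x:ℂ) - t‖) (by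
    apply Measurable.aestronglyMeasurable; fun_prop)
  apply this
  have hae : ∀ᵐ t ∂(volume.restrict (uIoc a b)), t ∉ ({-A, -1, 1, B, x} : Set ℝ) :=
      ae_restrict_of_ae ((Set.Finite.countable (by simp)).ae_notMem _)
  filter_upwards [hae] with t ht
  simp only [mem_insert_iff, mem_singleton_iff, not_or] at ht
  have := H x t ht.1 ht.2.1 ht.2.2.1 ht.2.2.2.1 ht.2.2.2.2 0 le_rfl one_pos
  simp only [Complex.ofReal_zero, zero_mul, add_zero] at this
  refine le_trans ?_ (this.trans (le_abs_self _))
  unfold Ffn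
  rw [norm_mul, norm_mul]
  gcongr
  · unfold rho
    rw [norm_div, norm_neg, Real.norm_eq_abs, Real.norm_of_nonneg Real.pi_pos.le]
    have h1 := Complex.abs_im_le_norm (hfn A B C t)
    apply (div_le_self (abs_nonneg _) (by linarith [Real.pi_gt_three])).trans h1
  · have h1 := Complex.abs_re_le_norm (Complex.log ((t:ℂ) - x))
    rw [Complex.log_re, norm_sub_rev] at h1
    exact h1

lemma rho_log_int {A B : ℝ} (C : ℝ) (hA : 1 < A) (hB : 1 < B) (x : ℝ) :
    Integrable (fun t => rho A B C t * Real.log ‖(x:ℂ) - t‖) :=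
  int_of_ii hA hB _ (fun T => rho_log_ii C hA hB x _ _)

lemma arg_int {A B : ℝ} (C : ℝ) (hA : 1 < A) (hB : 1 < B) (x T : ℝ) (h1 : -T ≤ x) (h2 : x ≤ T) :
    IntervalIntegrable (fun t : ℝ => (hfn A B C t).re * Complex.arg ((t:ℂ) - x)) volume (-T) T ∧
    ∫ t in (-T)..T, (hfn A B C t).re * Complex.arg ((t:ℂ) - x) = π * ∫ t in (-T)..x, (hfn A B C t).re := by
  have e1 : ∀ t ∈ Ioo (-T) x, (hfn A B C t).re * Complex.arg ((t:ℂ) - x) = π * (hfn A B C t).re := by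
    intro t ht
    rw [← Complex.ofReal_sub, Complex.arg_ofReal_of_neg (by linarith [ht.2])]; ring
  have e2 : ∀ t ∈ Ioo x T, (hfn A B C t).re * Complex.arg ((t:ℂ) - x) = 0 := by
    intro t ht
    rw [← Complex.ofReal_sub, Complex.arg_ofReal_of_nonneg (by linarith [ht.1])]; ring
  have i1 : IntervalIntegrable (fun t : ℝ => (hfn A B C t).re * Complex.arg ((t:ℂ) - x)) volume (-T) x := by
    have := (hfn_ii C hA hB (-T) x).cre.const_mul π
    rw [intervalIntegrable_iff_integrableOn_Ioo_of_le h1] at this ⊢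
    exact this.congr_fun (fun t ht => (e1 t ht).symm) measurableSet_Ioo
  have i2 : IntervalIntegrable (fun t : ℝ => (hfn A B C t).re * Complex.arg ((t:ℂ) - x)) volume x T := by
    have := (intervalIntegrable_const (c := (0:ℝ)) (μ := volume) (a := x) (b := T))
    rw [intervalIntegrable_iff_integrableOn_Ioo_of_le h2] at this ⊢
    exact this.congr_fun (fun t ht => (e2 t ht).symm) measurableSet_Ioo
  refine ⟨i1.trans i2, ?_⟩
  rw [← intervalIntegral.integral_add_adjacent_intervals i1 i2]
  rw [intervalIntegral.integral_of_le h2, integral_Ioc_eq_integral_Ioo, setIntegral_congr_fun measurableSet_Ioo e2]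
  rw [intervalIntegral.integral_of_le h1, integral_Ioc_eq_integral_Ioo, setIntegral_congr_fun measurableSet_Ioo e1]
  rw [intervalIntegral.integral_of_le h1, integral_Ioc_eq_integral_Ioo, integral_const_mul]
  simp

theorem Upot_sub {A B : ℝ} (C : ℝ) (hA : 1 < A) (hB : 1 < B) (x1 x2 : ℝ) :
    Upot A B C x1 - Upot A B C x2 = ∫ t in x2..x1, (hfn A B C t).re := by
  have hlim := log_identity C hA hB x1 x2
  have him := (Complex.continuous_im.tendsto _).comp hlim
  have hev : ∀ᶠ T : ℝ in atTop, (Complex.im ∘ fun T : ℝ => ∫ t in (-T)..T, (Ffn A B C x1 t - Ffn A B C x2 t)) T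
      = π * ((∫ t in x2..x1, (hfn A B C t).re) - (Upot A B C x1 - Upot A B C x2)) := by
    filter_upwards [eventually_gt_atTop (A + B), eventually_ge_atTop |x1|, eventually_ge_atTop |x2|] with T hT hT1 hT2
    rw [abs_le] at hT1 hT2
    simp only [Function.comp]
    rw [intervalIntegral.integral_sub (Ffn_ii C hA hB _ _ _) (Ffn_ii C hA hB _ _ _), Complex.sub_im,
      int_im (Ffn_ii C hA hB _ _ _), int_im (Ffn_ii C hA hB _ _ _)]
    have key : ∀ x, -T ≤ x → x ≤ T → ∫ t in (-T)..T, (Ffn A B C x t).im = - π * Upot A B C x + π * ∫ t in (-T)..x, (hfn A B C t).re := by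
      intro x h1 h2
      obtain ⟨i1, i2⟩ := arg_int C hA hB x T h1 h2
      rw [← i2]
      unfold Upot
      rw [← intervalIntegral.integral_eq_integral_of_support_subset (supp_I hA hB _ hT),
        ← intervalIntegral.integral_const_mul, ← intervalIntegral.integral_add ((rho_log_ii C hA hB x _ _).const_mul _) i1]
      apply intervalIntegral.integral_congr
      intro t _
      simp only [Ffn, Complex.mul_im, Complex.log_re, Complex.log_im, rho]
      rw [norm_sub_rev (x:ℂ) t]
      field_simp
      ring
    rw [key x1 hT1.1 hT1.2, key x2 hT2.1 hT2.2, ← intervalIntegral.integral_interval_sub_left (hfn_ii C hA hB (-T) x1).cre (hfn_ii C hA hB (-T) x2).cre]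
    ring
  have h0 := tendsto_nhds_unique (him.congr' hev) tendsto_const_nhds
  simp only [Complex.zero_im] at h0
  have := (mul_eq_zero.1 h0.symm).resolve_left Real.pi_ne_zero
  linarith

theorem rho_mass {A B : ℝ} (C : ℝ) (hA : 1 < A) (hB : 1 < B) : ∫ t, rho A B C t = 1 := by
  have hlim := mass_identity C hA hB
  have him := (Complex.continuous_im.tendsto _).comp hlim
  have hne : ∀ t : ℝ, (t:ℂ) + Complex.I ≠ 0 := by
    intro t h
    have := congrArg Complex.im h
    simp at this
  have hev : ∀ᶠ T : ℝ in atTop, (Complex.im ∘ fun T : ℝ => ∫ t in (-T)..T, (hfn A B C t - 1 / ((t:ℂ) + Complex.I))) T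
      = - π * (∫ t, rho A B C t) + (Real.arctan T - Real.arctan (-T)) := by
    filter_upwards [eventually_gt_atTop (A + B)] with T hT
    have ic : IntervalIntegrable (fun t : ℝ => 1 / ((t:ℂ) + Complex.I)) volume (-T) T := by
      apply Continuous.intervalIntegrable
      exact Continuous.div (by fun_prop) (by fun_prop) hne
    simp only [Function.comp]
    rw [int_im ((hfn_ii C hA hB _ _).sub ic), ← integral_inv_one_add_sq]
    have s : Function.support (rho A B C) ⊆ Ioc (-T) T := by
      simpa using supp_I (C := C) hA hB (fun _ => 1) hT
    rw [← intervalIntegral.integral_eq_integral_of_support_subset s, ← intervalIntegral.integral_const_mul,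
      ← intervalIntegral.integral_add ((rho_ii C hA hB _ _).const_mul _) (by
        apply Continuous.intervalIntegrable
        exact Continuous.inv₀ (by fun_prop) (fun x => by positivity))]
    apply intervalIntegral.integral_congr
    intro t _
    simp only [Complex.sub_im, rho, one_div, Complex.inv_im, Complex.add_im, Complex.ofReal_im, Complex.I_im, Complex.normSq_apply,
      Complex.add_re, Complex.ofReal_re, Complex.I_re]
    have : 1 + t^2 ≠ 0 := by positivity
    have h2 : (t + 0) * (t + 0) + (0 + 1) * (0 + 1) = 1 + t^2 := by ring
    rw [h2]
    field_simp
    ring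
  have h1 := him.congr' hev
  have h2 : Tendsto (fun T : ℝ => - π * (∫ t, rho A B C t) + (Real.arctan T - Real.arctan (-T))) atTop (nhds (- π * (∫ t, rho A B C t) + (π/2 - -(π/2)))) := by
    have a1 := Real.tendsto_arctan_atTop.mono_right nhdsWithin_le_nhds
    have a2 := (Real.tendsto_arctan_atBot.mono_right nhdsWithin_le_nhds).comp tendsto_neg_atTop_atBot
    exact (a1.sub a2).const_add _
  have h3 := tendsto_nhds_unique h1 h2
  simp only [Complex.zero_im] at h3
  have : π * (∫ t, rho A B C t) = π * 1 := by linarith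
  exact mul_left_cancel₀ Real.pi_ne_zero this


lemma ii_nonpos {f : ℝ → ℝ} {a b : ℝ} (h : a ≤ b) (hf : ∀ t ∈ Icc a b, f t ≤ 0) : ∫ t in a..b, f t ≤ 0 := by
  rw [← neg_nonneg, ← intervalIntegral.integral_neg]
  exact intervalIntegral.integral_nonneg h (fun t ht => by linarith [hf t ht])

lemma gap_re {A B C t : ℝ} (hA : 1 < A) (hB : 1 < B) (h1 : -1 ≤ t) (h2 : t ≤ 1) :
    (hfn A B C t).re = (C - t) * wt A B t := by
  rw [hfn_gap hA hB h1 h2, Complex.ofReal_re, wt, mul_one_div]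
  congr 1
  rw [← Real.sqrt_mul (by linarith), ← Real.sqrt_mul (mul_nonneg (by linarith) (by linarith)), ← Real.sqrt_mul (mul_nonneg (mul_nonneg (by linarith) (by linarith)) (by linarith))]
  congr 1; ring

lemma gap_ii {A B : ℝ} (C : ℝ) (hA : 1 < A) (hB : 1 < B) :
    IntervalIntegrable (fun t => (C - t) * wt A B t) volume (-1) 1 := by
  have := (hfn_ii C hA hB (-1) 1).cre
  refine this.congr ?_
  intro t ht
  rw [uIoc_of_le (by norm_num)] at ht
  exact gap_re hA hB ht.1.le ht.2

lemma wt_ii {A B : ℝ} (hA : 1 < A) (hB : 1 < B) : IntervalIntegrable (wt A B) volume (-1) 1 := by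
  have := (gap_ii 1 hA hB).sub (gap_ii 0 hA hB)
  convert this using 2
  simp; ring

lemma xwt_ii {A B : ℝ} (hA : 1 < A) (hB : 1 < B) : IntervalIntegrable (fun x => x * wt A B x) volume (-1) 1 := by
  have := (gap_ii 0 hA hB).neg
  convert this using 2
  simp

lemma wt_nonneg (A B t : ℝ) : 0 ≤ wt A B t := by unfold wt; positivity

lemma wt_pos {A B t : ℝ} (hA : 1 < A) (hB : 1 < B) (h1 : -1 < t) (h2 : t < 1) : 0 < wt A B t := by
  unfold wt
  have : 0 < (1 - t ^ 2) * (t + A) * (B - t) := by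
    apply mul_pos (mul_pos _ (by linarith)) (by linarith)
    nlinarith
  positivity

lemma wt_int_pos {A B : ℝ} (hA : 1 < A) (hB : 1 < B) : 0 < ∫ x in (-1 : ℝ)..1, wt A B x :=
  intervalIntegral.intervalIntegral_pos_of_pos_on (wt_ii hA hB) (fun x hx => wt_pos hA hB hx.1 hx.2) (by norm_num)

lemma gap_int_zero {A B : ℝ} (hA : 1 < A) (hB : 1 < B) : ∫ t in (-1 : ℝ)..1, (Ccrit A B - t) * wt A B t = 0 := by
  simp_rw [sub_mul]
  rw [intervalIntegral.integral_sub ((wt_ii hA hB).const_mul _) (xwt_ii hA hB), intervalIntegral.integral_const_mul]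
  unfold Ccrit
  rw [div_mul_cancel₀ _ (wt_int_pos hA hB).ne', sub_self]

lemma Ccrit_lt {A B : ℝ} (hA : 1 < A) (hB : 1 < B) : Ccrit A B < 1 := by
  by_contra! h
  have := intervalIntegral.intervalIntegral_pos_of_pos_on (gap_ii (Ccrit A B) hA hB) (fun x hx => mul_pos (by linarith [hx.2]) (wt_pos hA hB hx.1 hx.2)) (by norm_num)
  rw [gap_int_zero hA hB] at this
  exact lt_irrefl _ this

lemma Ccrit_gt {A B : ℝ} (hA : 1 < A) (hB : 1 < B) : -1 < Ccrit A B := by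
  by_contra! h
  have := intervalIntegral.intervalIntegral_pos_of_pos_on (gap_ii (Ccrit A B) hA hB).neg (fun x hx => by
    have : 0 < (x - Ccrit A B) * wt A B x := mul_pos (by linarith [hx.1]) (wt_pos hA hB hx.1 hx.2)
    simp only [Pi.neg_apply]
    linarith) (by norm_num)
  simp only [Pi.neg_apply] at this
  rw [intervalIntegral.integral_neg, gap_int_zero hA hB] at this
  simp at this

/-- abstract properties of the equilibrium potential -/
structure Pot (A B C γ η : ℝ) (ρ : ℝ → ℝ) (U : ℂ → ℝ) : Prop where
  hA : 1 < A
  hB : 1 < B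
  hC1 : -1 < C
  hC2 : C < 1
  eta0 : 0 ≤ η
  Ueq : ∀ z : ℂ, U z = ∫ t : ℝ, ρ t * Real.log ‖z - t‖
  int : Integrable ρ
  nonneg : ∀ t, 0 ≤ ρ t
  supp : ∀ t, t ∉ Icc (-A) (-1) ∪ Icc 1 B → ρ t = 0
  mass : ∫ t, ρ t = 1
  logint : ∀ x : ℝ, Integrable (fun t : ℝ => ρ t * Real.log ‖(x:ℂ) - t‖)
  UI : ∀ x : ℝ, x ∈ Icc (-A) (-1) ∪ Icc 1 B → U x = γ
  UC : U C = γ + η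
  Ule : ∀ x : ℝ, x ∈ Icc (-A) B → U x ≤ γ + η
  Uge : ∀ x : ℝ, γ ≤ U x
  Ucont : Continuous (fun x : ℝ => U x)

lemma Upot_cont {A B : ℝ} (C : ℝ) (hA : 1 < A) (hB : 1 < B) : Continuous (fun x : ℝ => Upot A B C x) := by
  have : (fun x : ℝ => Upot A B C x) = fun x : ℝ => (∫ t in (0:ℝ)..x, (hfn A B C t).re) + Upot A B C (0:ℝ) := by
    ext x
    rw [← Upot_sub C hA hB]; ring
  rw [this]
  refine Continuous.add ?_ continuous_const
  exact intervalIntegral.continuous_primitive (fun a b => (hfn_ii C hA hB a b).cre) 0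

theorem pot_exists {A B : ℝ} (hA : 1 < A) (hB : 1 < B) : ∃ γ ρ U, Pot A B (Ccrit A B) γ (eta A B) ρ U := by
  set C := Ccrit A B with hCd
  have hC1 : -1 < C := Ccrit_gt hA hB
  have hC2 : C < 1 := Ccrit_lt hA hB
  have hsub := Upot_sub C hA hB
  have hgap : ∀ a b : ℝ, -1 ≤ a → a ≤ b → b ≤ 1 → Upot A B C b - Upot A B C a = ∫ t in a..b, (C - t) * wt A B t := by
    intro a b h1 h2 h3
    rw [hsub]
    apply intervalIntegral.integral_congr
    intro t ht
    rw [uIcc_of_le h2] at ht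
    exact gap_re hA hB (h1.trans ht.1) (ht.2.trans h3)
  have hup : ∀ a b : ℝ, -1 ≤ a → a ≤ b → b ≤ C → Upot A B C a ≤ Upot A B C b := by
    intro a b h1 h2 h3
    rw [← sub_nonneg, hgap a b h1 h2 (by linarith)]
    apply intervalIntegral.integral_nonneg h2
    intro t ht
    exact mul_nonneg (by linarith [ht.2]) (wt_nonneg _ _ _)
  have hdn : ∀ a b : ℝ, C ≤ a → a ≤ b → b ≤ 1 → Upot A B C b ≤ Upot A B C a := by
    intro a b h1 h2 h3
    rw [← sub_nonpos, hgap a b (by linarith) h2 h3]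
    apply ii_nonpos h2
    intro t ht
    exact mul_nonpos_of_nonpos_of_nonneg (by linarith [ht.1]) (wt_nonneg _ _ _)
  have e1 : Upot A B C (1:ℝ) = Upot A B C (-1:ℝ) := by
    rw [← sub_eq_zero, hgap (-1) 1 le_rfl (by norm_num) le_rfl]
    exact gap_int_zero hA hB
  have hL : ∀ x, -A ≤ x → x ≤ -1 → Upot A B C x = Upot A B C (1:ℝ) := by
    intro x h1 h2
    rw [e1, eq_comm, ← sub_eq_zero, hsub]
    rw [intervalIntegral.integral_congr (g := fun _ => (0:ℝ))]
    · simp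
    · intro t ht
      rw [uIcc_of_le h2] at ht
      exact re_left hB (h1.trans ht.1) ht.2
  have hR : ∀ x, 1 ≤ x → x ≤ B → Upot A B C x = Upot A B C (1:ℝ) := by
    intro x h1 h2
    rw [← sub_eq_zero, hsub]
    rw [intervalIntegral.integral_congr (g := fun _ => (0:ℝ))]
    · simp
    · intro t ht
      rw [uIcc_of_le h1] at ht
      exact re_right hA ht.1 (ht.2.trans h2)
  have hUC : Upot A B C C = Upot A B C (1:ℝ) + eta A B := by
    have := hgap (-1) C le_rfl hC1.le hC2.le
    rw [eta, ← hCd, ← this, e1]; ring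
  have hgl : ∀ x : ℝ, -1 ≤ x → x ≤ 1 → Upot A B C (1:ℝ) ≤ Upot A B C x ∧ Upot A B C x ≤ Upot A B C C := by
    intro x h1 h2
    rcases le_total x C with h | h
    · exact ⟨by rw [e1]; exact hup _ _ le_rfl h1 h, hup _ _ h1 h le_rfl⟩
    · exact ⟨hdn _ _ h h2 le_rfl, hdn _ _ le_rfl h h2⟩
  have heta : 0 ≤ eta A B := by
    have := (hgl C hC1.le hC2.le).1
    rw [hUC] at this; linarith
  refine ⟨Upot A B C (1:ℝ), rho A B C, Upot A B C, hA, hB, hC1, hC2, heta, fun z => rfl, rho_int C hA hB, rho_nonneg hA hB hC1 hC2, fun t ht => rho_zero hA hB ht, rho_mass C hA hB, rho_log_int C hA hB, ?_, hUC, ?_, ?_, Upot_cont C hA hB⟩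
  · rintro x (h | h)
    · exact hL x h.1 h.2
    · exact hR x h.1 h.2
  · intro x hx
    rcases le_total x (-1) with h | h
    · rw [hL x hx.1 h]; linarith
    · rcases le_total x 1 with h' | h'
      · rw [← hUC]; exact (hgl x h h').2
      · rw [hR x h' hx.2]; linarith
  · intro x
    rcases le_total x (-1) with h | h
    · rcases le_total x (-A) with h' | h'
      · rw [← hL (-A) le_rfl (by linarith), ← sub_nonpos, hsub]
        apply ii_nonpos h'
        intro t ht
        exact re_oleft hA hB hC1 ht.2
      · rw [hL x h' h]
    · rcases le_total x 1 with h' | h'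
      · exact (hgl x h h').1
      · rcases le_total x B with h2 | h2
        · rw [hR x h' h2]
        · rw [← hR B hB.le le_rfl, ← sub_nonneg, hsub]
          apply intervalIntegral.integral_nonneg h2
          intro t ht
          exact re_oright hA hB hC2 ht.1


lemma log_lip {a b d : ℝ} (hd : 0 < d) (ha : d ≤ a) (hb : d ≤ b) : |Real.log a - Real.log b| ≤ |a - b| / d := by
  have key : ∀ a b : ℝ, d ≤ a → d ≤ b → Real.log a - Real.log b ≤ |a - b| / d := by
    intro a b ha hb
    have hb0 : 0 < b := by linarith
    have ha0 : 0 < a := by linarith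
    rw [← Real.log_div ha0.ne' hb0.ne']
    have := Real.log_le_sub_one_of_pos (div_pos ha0 hb0)
    refine this.trans ?_
    rw [div_sub_one hb0.ne']
    calc (a - b) / b ≤ |a - b| / b := by gcongr; exact le_abs_self _
      _ ≤ |a - b| / d := by gcongr
  rw [abs_le]
  constructor
  · have := key b a hb ha
    rw [abs_sub_comm] at this
    linarith
  · exact key a b ha hb

lemma log_norm_lip {z w t s : ℂ} {d : ℝ} (hd : 0 < d) (ha : d ≤ ‖z - t‖) (hb : d ≤ ‖w - s‖) :
    |Real.log ‖z - t‖ - Real.log ‖w - s‖| ≤ ‖(z - t) - (w - s)‖ / d :=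
  (log_lip hd ha hb).trans (by gcongr; exact abs_norm_sub_norm_le _ _)

section
variable {A B C γ η : ℝ} {ρ : ℝ → ℝ} {U : ℂ → ℝ}

lemma Pot.clogint (P : Pot A B C γ η ρ U) {z : ℂ} {d : ℝ} (hd : 0 < d)
    (hz : ∀ t ∈ Icc (-A) (-1) ∪ Icc 1 B, d ≤ ‖z - (t:ℝ)‖) :
    Integrable (fun t : ℝ => ρ t * Real.log ‖z - t‖) := by
  have hA := P.hA
  have hB := P.hB
  refine (P.int.mul_const (|Real.log d| + (‖z‖ + (A + B)))).mono' ?_ ?_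
  · refine P.int.aestronglyMeasurable.mul ?_
    apply Measurable.aestronglyMeasurable; fun_prop
  · refine Eventually.of_forall fun t => ?_
    rw [norm_mul, Real.norm_of_nonneg (P.nonneg t)]
    by_cases ht : t ∈ Icc (-A) (-1) ∪ Icc 1 B
    · have h := hz t ht
      apply mul_le_mul_of_nonneg_left _ (P.nonneg t)
      rw [Real.norm_eq_abs, abs_le]
      have h1 : ‖z - t‖ ≤ ‖z‖ + (A + B) := by
        refine (norm_sub_le _ _).trans ?_
        gcongr
        rw [Complex.norm_real, Real.norm_eq_abs, abs_le]
        rcases ht with ht | ht <;> constructor <;> linarith [ht.1, ht.2]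
      have h2 := Real.log_le_log hd h
      have h3 := neg_abs_le (Real.log d)
      have h4 := Real.log_le_sub_one_of_pos (hd.trans_le h)
      have h5 := norm_nonneg z
      constructor <;> linarith [abs_nonneg (Real.log d)]
    · rw [P.supp t ht]; simp

lemma Pot.ge (P : Pot A B C γ η ρ U) {z : ℂ} {d : ℝ} (hd : 0 < d)
    (hz : ∀ t ∈ Icc (-A) (-1) ∪ Icc 1 B, d ≤ ‖z - (t:ℝ)‖) : γ ≤ U z := by
  refine (P.Uge z.re).trans ?_
  rw [P.Ueq, P.Ueq]
  apply integral_mono_ae (P.logint _) (P.clogint hd hz)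
  have hae : ∀ᵐ t : ℝ, t ≠ z.re := by
    have := (Set.countable_singleton z.re).ae_notMem volume
    simpa using this
  filter_upwards [hae] with t ht
  apply mul_le_mul_of_nonneg_left _ (P.nonneg t)
  apply Real.log_le_log
  · rw [norm_pos_iff, sub_ne_zero]
    exact_mod_cast ht.symm
  · rw [← Complex.ofReal_sub, Complex.norm_real, Real.norm_eq_abs]
    simpa using Complex.abs_re_le_norm (z - t)

lemma im_le_dist (x y t : ℝ) (hy : 0 ≤ y) : y ≤ ‖((x:ℂ) + y * Complex.I) - t‖ := by
  have := Complex.abs_im_le_norm (((x:ℂ) + y * Complex.I) - t)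
  simp at this
  rwa [abs_of_nonneg hy] at this

lemma norm_xy_mono (x t : ℝ) {y y' : ℝ} (h0 : 0 ≤ y) (h : y ≤ y') :
    ‖((x:ℂ) + y * Complex.I) - t‖ ≤ ‖((x:ℂ) + y' * Complex.I) - t‖ := by
  have e : ∀ y : ℝ, ((x:ℂ) + y * Complex.I) - t = ((x - t : ℝ) : ℂ) + y * Complex.I := by
    intro y; push_cast; ring
  rw [e, e, Complex.norm_add_mul_I, Complex.norm_add_mul_I]
  apply Real.sqrt_le_sqrt
  gcongr

lemma Pot.unif (P : Pot A B C γ η ρ U) {ε : ℝ} (hε : 0 < ε) :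
    ∃ y : ℝ, 0 < y ∧ y < 1 ∧ ∀ x ∈ Icc (-A) B, U ((x:ℂ) + y * Complex.I) ≤ U x + ε := by
  have hy : ∀ n : ℕ, (0:ℝ) < 1 / ((n:ℝ) + 2) := fun n => by positivity
  have hint : ∀ (n : ℕ) (x : ℝ), Integrable (fun t : ℝ => ρ t * Real.log ‖((x:ℂ) + (1 / ((n:ℝ) + 2) : ℝ) * Complex.I) - t‖) :=
    fun n x => P.clogint (hy n) (fun t _ => im_le_dist _ _ _ (hy n).le)
  have hanti : ∀ x ∈ Icc (-A) B, Antitone (fun n : ℕ => U ((x:ℂ) + (1 / ((n:ℝ) + 2) : ℝ) * Complex.I)) := by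
    intro x _ n m hnm
    simp only [P.Ueq]
    apply integral_mono (hint m x) (hint n x)
    intro t
    apply mul_le_mul_of_nonneg_left _ (P.nonneg t)
    apply Real.log_le_log ((hy m).trans_le (im_le_dist _ _ _ (hy m).le))
    apply norm_xy_mono _ _ (hy m).le
    apply one_div_le_one_div_of_le (by positivity)
    have : (n:ℝ) ≤ m := by exact_mod_cast hnm
    linarith
  have hcont : ∀ n : ℕ, ContinuousOn (fun x : ℝ => U ((x:ℂ) + (1 / ((n:ℝ) + 2) : ℝ) * Complex.I)) (Icc (-A) B) := by
    intro n
    apply Continuous.continuousOn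
    have : LipschitzWith (Real.toNNReal (1 / (1 / ((n:ℝ) + 2)))) (fun x : ℝ => U ((x:ℂ) + (1 / ((n:ℝ) + 2) : ℝ) * Complex.I)) := by
      apply LipschitzWith.of_dist_le_mul
      intro x x'
      rw [Real.coe_toNNReal _ (by positivity), Real.dist_eq, Real.dist_eq, P.Ueq, P.Ueq, ← integral_sub (hint n x) (hint n x')]
      rw [← Real.norm_eq_abs]
      refine (norm_integral_le_of_norm_le (P.int.mul_const (1 / (1 / ((n:ℝ) + 2)) * |x - x'|)) ?_).trans ?_
      · refine Eventually.of_forall fun t => ?_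
        rw [← mul_sub, norm_mul, Real.norm_of_nonneg (P.nonneg t), Real.norm_eq_abs]
        apply mul_le_mul_of_nonneg_left _ (P.nonneg t)
        refine (log_norm_lip (hy n) (im_le_dist _ _ _ (hy n).le) (im_le_dist _ _ _ (hy n).le)).trans ?_
        apply le_of_eq
        rw [show ∀ a b c : ℂ, a + b - c - (x' + b - c) = a - x' by intros; ring, ← Complex.ofReal_sub, Complex.norm_real, Real.norm_eq_abs]
        ring
      · rw [integral_mul_const, P.mass, one_mul]
    exact this.continuous
  have htend : ∀ x ∈ Icc (-A) B, Tendsto (fun n : ℕ => U ((x:ℂ) + (1 / ((n:ℝ) + 2) : ℝ) * Complex.I)) atTop (nhds (U x)) := by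
    intro x _
    simp only [P.Ueq]
    have hae : ∀ᵐ t : ℝ, t ≠ x := by
      have := (Set.countable_singleton x).ae_notMem volume
      simpa using this
    apply tendsto_integral_of_dominated_convergence (fun t => |ρ t * Real.log ‖(x:ℂ) - t‖| + |ρ t * Real.log ‖((x:ℂ) + (1 / (((0:ℕ):ℝ) + 2) : ℝ) * Complex.I) - t‖|)
    · intro n; exact (hint n x).aestronglyMeasurable
    · exact (P.logint x).abs.add (hint 0 x).abs
    · intro n
      filter_upwards [hae] with t ht
      rw [norm_mul, abs_mul, abs_mul, ← mul_add, Real.norm_eq_abs, abs_of_nonneg (P.nonneg t), Real.norm_eq_abs]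
      apply mul_le_mul_of_nonneg_left _ (P.nonneg t)
      have h1 : Real.log ‖(x:ℂ) - t‖ ≤ Real.log ‖((x:ℂ) + (1 / ((n:ℝ) + 2) : ℝ) * Complex.I) - t‖ := by
        apply Real.log_le_log
        · rw [norm_pos_iff, sub_ne_zero]
          exact_mod_cast ht.symm
        · simpa using norm_xy_mono x t le_rfl (hy n).le
      have h2 : Real.log ‖((x:ℂ) + (1 / ((n:ℝ) + 2) : ℝ) * Complex.I) - t‖ ≤ Real.log ‖((x:ℂ) + (1 / (((0:ℕ):ℝ) + 2) : ℝ) * Complex.I) - t‖ := by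
        apply Real.log_le_log ((hy n).trans_le (im_le_dist _ _ _ (hy n).le))
        apply norm_xy_mono _ _ (hy n).le
        apply one_div_le_one_div_of_le (by positivity)
        simp
      rw [abs_le]
      constructor
      · linarith [neg_abs_le (Real.log ‖(x:ℂ) - t‖), abs_nonneg (Real.log ‖((x:ℂ) + (1 / (((0:ℕ):ℝ) + 2) : ℝ) * Complex.I) - t‖)]
      · linarith [abs_nonneg (Real.log ‖(x:ℂ) - t‖), le_abs_self (Real.log ‖((x:ℂ) + (1 / (((0:ℕ):ℝ) + 2) : ℝ) * Complex.I) - t‖)]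
    · filter_upwards [hae] with t ht
      refine Tendsto.const_mul _ ?_
      have hne : ‖(x:ℂ) - t‖ ≠ 0 := by
        rw [norm_ne_zero_iff, sub_ne_zero]
        exact_mod_cast ht.symm
      refine ((Real.continuousAt_log hne).tendsto).comp ?_
      have h0 : Tendsto (fun n : ℕ => (1 / ((n:ℝ) + 2) : ℝ)) atTop (nhds 0) := by
        have := tendsto_one_div_add_atTop_nhds_zero_nat (𝕜 := ℝ)
        have := this.comp (tendsto_add_atTop_nat 1)
        refine this.congr fun n => ?_
        simp only [Function.comp]; push_cast; ring
      have h1 : Continuous (fun y : ℝ => ‖(x:ℂ) + y * Complex.I - t‖) := by fun_prop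
      have := (h1.tendsto 0).comp h0
      simp only [Complex.ofReal_zero, zero_mul, add_zero] at this
      exact this
  have := Antitone.tendstoUniformlyOn_of_forall_tendsto isCompact_Icc hcont hanti P.Ucont.continuousOn htend
  rw [Metric.tendstoUniformlyOn_iff] at this
  obtain ⟨n, hn⟩ := (this ε hε).exists
  refine ⟨1 / ((n:ℝ) + 2), hy n, ?_, ?_⟩
  · rw [div_lt_one (by positivity)]
    linarith [(Nat.cast_nonneg n : (0:ℝ) ≤ n)]
  · intro x hx
    have := hn x hx
    rw [Real.dist_eq, abs_lt] at this
    linarith [this.1]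

lemma Pot.supp' (P : Pot A B C γ η ρ U) {t : ℝ} (h : t ∉ Icc (-A) B) : ρ t = 0 := by
  have hA := P.hA
  have hB := P.hB
  apply P.supp t
  rintro (h' | h')
  · exact h ⟨h'.1, by linarith [h'.2]⟩
  · exact h ⟨by linarith [h'.1], h'.2⟩

lemma Pot.int_eq (P : Pot A B C γ η ρ U) (f : ℝ → ℝ) : ∫ t, ρ t * f t = ∫ t in (-A)..B, ρ t * f t := by
  have hA := P.hA
  have hB := P.hB
  rw [intervalIntegral.integral_of_le (by linarith), ← integral_Icc_eq_integral_Ioc, setIntegral_eq_integral_of_forall_compl_eq_zero]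
  intro t ht
  rw [P.supp' ht, zero_mul]

lemma Pot.disc (P : Pot A B C γ η ρ U) {N : ℕ} (hN : 0 < N) :
    ∃ τ : ℕ → ℝ, (∀ j < N, τ j ∈ Icc (-A) (-1) ∪ Icc 1 B) ∧ ∀ (d : ℝ) (z : ℂ), 0 < d →
      (∀ t ∈ Icc (-A) (-1) ∪ Icc 1 B, d ≤ ‖z - (t:ℝ)‖) →
      |∑ j ∈ Finset.range N, Real.log ‖z - τ j‖ - N * U z| ≤ N * ((A + B) / d / N) := by
  have hA := P.hA
  have hB := P.hB
  have hN' : (0:ℝ) < N := by exact_mod_cast hN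
  have hAB : -A ≤ B := by linarith
  set F : ℝ → ℝ := fun x => ∫ t in (-A)..x, ρ t with hF
  have hii : ∀ a b : ℝ, IntervalIntegrable ρ volume a b := fun a b => P.int.intervalIntegrable
  have hFc : Continuous F := intervalIntegral.continuous_primitive hii _
  have hF0 : F (-A) = 0 := by simp [hF]
  have hF1 : F B = 1 := by
    have := P.int_eq (fun _ => 1)
    simp only [mul_one] at this
    rw [P.mass] at this
    exact this.symm
  have hFs : ∀ a b, F b - F a = ∫ t in a..b, ρ t := fun a b => by
    simp only [hF]
    rw [intervalIntegral.integral_interval_sub_left (hii _ _) (hii _ _)]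
  have hFm : Monotone F := by
    intro a b hab
    rw [← sub_nonneg, hFs]
    exact intervalIntegral.integral_nonneg hab (fun t _ => P.nonneg t)
  have hs : ∀ j : ℕ, ∃ s ∈ Icc (-A) B, j ≤ N → (F s = j / N ∧ (j = 0 → s = -A) ∧ (j = N → s = B)) := by
    intro j
    rcases Nat.eq_zero_or_pos j with h | h
    · exact ⟨-A, ⟨le_rfl, hAB⟩, fun _ => ⟨by simp [h, hF0], fun _ => rfl, fun _ => by omega⟩⟩
    · rcases lt_trichotomy j N with h' | h' | h'
      · have hj : (j:ℝ) < N := by exact_mod_cast h'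
        have := intermediate_value_Icc hAB hFc.continuousOn
        rw [hF0, hF1] at this
        obtain ⟨s, hs, hs'⟩ := this (show (j / N : ℝ) ∈ Icc (0:ℝ) 1 from ⟨by positivity, by rw [div_le_one hN']; exact hj.le⟩)
        exact ⟨s, hs, fun _ => ⟨hs', fun _ => by omega, fun _ => by omega⟩⟩
      · exact ⟨B, ⟨hAB, le_rfl⟩, fun _ => ⟨by rw [hF1, h', div_self hN'.ne'], fun _ => by omega, fun _ => rfl⟩⟩
      · exact ⟨B, ⟨hAB, le_rfl⟩, fun _ => by omega⟩
  choose s hsI hs using hs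
  have hmass : ∀ j < N, ∫ t in (s j)..(s (j+1)), ρ t = 1 / N := by
    intro j hj
    rw [← hFs, (hs j hj.le).1, (hs (j+1) hj).1]
    push_cast; ring
  have hlt : ∀ j < N, s j ≤ s (j+1) := by
    intro j hj
    by_contra! h
    have := hFm h.le
    rw [(hs j hj.le).1, (hs (j+1) hj).1, div_le_div_iff_of_pos_right hN'] at this
    push_cast at this
    linarith
  have hτ : ∀ j, ∃ τ, j < N → (τ ∈ Icc (-A) (-1) ∪ Icc 1 B ∧ τ ∈ Icc (s j) (s (j+1))) := by
    intro j
    by_cases hj : j < N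
    · by_contra! h
      have h0 : ∫ t in (s j)..(s (j+1)), ρ t = 0 := by
        rw [intervalIntegral.integral_congr (g := fun _ => (0:ℝ))]
        · simp
        · intro t ht
          rw [uIcc_of_le (hlt j hj)] at ht
          apply P.supp
          intro h'
          exact (h t).2 h' ht
      rw [hmass j hj] at h0
      simp at h0
      omega
    · exact ⟨0, fun h => absurd h hj⟩
  choose τ hτ using hτ
  refine ⟨τ, fun j hj => (hτ j hj).1, ?_⟩
  intro d z hd hz
  have hli := P.clogint hd hz
  have hU : U z = ∑ j ∈ Finset.range N, ∫ t in (s j)..(s (j+1)), ρ t * Real.log ‖z - t‖ := by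
    rw [P.Ueq, P.int_eq, intervalIntegral.sum_integral_adjacent_intervals (fun k _ => hli.intervalIntegrable)]
    rw [(hs 0 hN.le).2.1 rfl, (hs N le_rfl).2.2 rfl]
  rw [hU, Finset.mul_sum, ← Finset.sum_sub_distrib]
  refine (Finset.abs_sum_le_sum_abs _ _).trans ?_
  have hterm : ∀ j ∈ Finset.range N, |Real.log ‖z - τ j‖ - N * ∫ t in (s j)..(s (j+1)), ρ t * Real.log ‖z - t‖| ≤ (s (j+1) - s j) / d := by
    intro j hj
    rw [Finset.mem_range] at hj
    have e1 : Real.log ‖z - τ j‖ = N * ∫ t in (s j)..(s (j+1)), ρ t * Real.log ‖z - τ j‖ := by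
      rw [intervalIntegral.integral_mul_const, hmass j hj]
      field_simp
    rw [e1, ← mul_sub, ← intervalIntegral.integral_sub ((hii _ _).mul_const _) hli.intervalIntegrable, abs_mul, abs_of_pos hN']
    have : |∫ t in (s j)..(s (j+1)), (ρ t * Real.log ‖z - τ j‖ - ρ t * Real.log ‖z - t‖)| ≤ ∫ t in (s j)..(s (j+1)), ρ t * ((s (j+1) - s j) / d) := by
      rw [← Real.norm_eq_abs]
      apply intervalIntegral.norm_integral_le_of_norm_le (hlt j hj)
      · refine Eventually.of_forall fun t ht => ?_
        rw [← mul_sub, norm_mul, Real.norm_of_nonneg (P.nonneg t)]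
        by_cases htI : t ∈ Icc (-A) (-1) ∪ Icc 1 B
        · apply mul_le_mul_of_nonneg_left _ (P.nonneg t)
          rw [Real.norm_eq_abs]
          refine (log_norm_lip hd (hz _ (hτ j hj).1) (hz t htI)).trans ?_
          gcongr
          rw [show z - (τ j : ℂ) - (z - t) = ((t - τ j : ℝ) : ℂ) by push_cast; ring, Complex.norm_real, Real.norm_eq_abs, abs_le]
          have := (hτ j hj).2
          constructor <;> linarith [this.1, this.2, ht.1, ht.2]
        · rw [P.supp t htI]; simp
      · exact (hii _ _).mul_const _
    rw [intervalIntegral.integral_mul_const, hmass j hj] at this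
    calc _ ≤ (N:ℝ) * (1 / N * ((s (j+1) - s j) / d)) := by gcongr
      _ = _ := by field_simp
  refine (Finset.sum_le_sum hterm).trans ?_
  rw [← Finset.sum_div, Finset.sum_range_sub s, (hs 0 hN.le).2.1 rfl, (hs N le_rfl).2.2 rfl]
  apply le_of_eq
  field_simp
  ring
end


section
variable {A B C γ η : ℝ} {ρ : ℝ → ℝ} {U : ℂ → ℝ}

lemma Pot.poly (P : Pot A B C γ η ρ U) {d ε : ℝ} (hd : 0 < d) (hε : 0 < ε) :
    ∃ N : ℕ, 0 < N ∧ ∃ q : Polynomial ℝ, q.Monic ∧ q.natDegree = N ∧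
      (∀ z : ℂ, 2 * (A + B) ≤ ‖z‖ → (‖z‖ / 2) ^ N ≤ ‖(q.map Complex.ofRealHom).eval z‖) ∧
      (∀ z : ℂ, (∀ t ∈ Icc (-A) (-1) ∪ Icc 1 B, d ≤ ‖z - (t:ℝ)‖) →
        Real.exp (N * (U z - ε)) ≤ ‖(q.map Complex.ofRealHom).eval z‖ ∧
        ‖(q.map Complex.ofRealHom).eval z‖ ≤ Real.exp (N * (U z + ε))) ∧
      ∀ x ∈ Icc (-A) B, |q.eval x| ≤ Real.exp (N * (U x + 2 * ε)) := by
  have hA := P.hA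
  have hB := P.hB
  obtain ⟨y, hy0, hy1, hy⟩ := P.unif hε
  set d' := min d y with hd'
  have hd'0 : 0 < d' := lt_min hd hy0
  obtain ⟨N, hN⟩ := exists_nat_gt ((A + B) / d' / ε)
  have hNp : (0:ℝ) < N := lt_of_le_of_lt (by positivity) hN
  have hN0 : 0 < N := by exact_mod_cast hNp
  have hNε : (A + B) / d' / N ≤ ε := by
    rw [div_lt_iff₀ hε] at hN
    rw [div_le_iff₀ hNp]
    linarith
  obtain ⟨τ, hτ, H⟩ := P.disc hN0
  have key : ∀ z : ℂ, (∀ t ∈ Icc (-A) (-1) ∪ Icc 1 B, d' ≤ ‖z - (t:ℝ)‖) →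
        Real.exp (N * (U z - ε)) ≤ ∏ j ∈ Finset.range N, ‖z - τ j‖ ∧
        ∏ j ∈ Finset.range N, ‖z - τ j‖ ≤ Real.exp (N * (U z + ε)) := by
    intro z hz
    have h := H d' z hd'0 hz
    have h2 : ∏ j ∈ Finset.range N, ‖z - τ j‖ = Real.exp (∑ j ∈ Finset.range N, Real.log ‖z - τ j‖) := by
      rw [Real.exp_sum]
      apply Finset.prod_congr rfl
      intro j hj
      rw [Real.exp_log]
      exact hd'0.trans_le (hz _ (hτ j (Finset.mem_range.1 hj)))
    rw [h2, Real.exp_le_exp, Real.exp_le_exp]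
    have h3 := h.trans (mul_le_mul_of_nonneg_left hNε hNp.le)
    rw [abs_le] at h3
    constructor <;> linarith [h3.1, h3.2]
  have hqe : ∀ z : ℂ, ((∏ j ∈ Finset.range N, (Polynomial.X - Polynomial.C (τ j))).map Complex.ofRealHom).eval z = ∏ j ∈ Finset.range N, (z - τ j) := by
    intro z
    simp [Polynomial.map_prod, Polynomial.eval_prod]
  refine ⟨N, hN0, ∏ j ∈ Finset.range N, (Polynomial.X - Polynomial.C (τ j)), ?_, ?_, ?_, ?_, ?_⟩
  · exact Polynomial.monic_prod_of_monic _ _ (fun j _ => Polynomial.monic_X_sub_C _)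
  · rw [Polynomial.natDegree_prod_of_monic _ _ (fun j _ => Polynomial.monic_X_sub_C _)]
    simp
  · intro z hz
    rw [hqe, norm_prod]
    have : (‖z‖ / 2) ^ N = ∏ j ∈ Finset.range N, (‖z‖ / 2) := by rw [Finset.prod_const, Finset.card_range]
    rw [this]
    apply Finset.prod_le_prod (fun _ _ => by positivity)
    intro j hj
    have h1 : ‖(τ j : ℂ)‖ ≤ A + B := by
      rw [Complex.norm_real, Real.norm_eq_abs, abs_le]
      have ht := hτ j (Finset.mem_range.1 hj)
      rcases ht with ht | ht <;> constructor <;> linarith [ht.1, ht.2]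
    have := norm_sub_norm_le z (τ j)
    linarith
  · intro z hz
    rw [hqe, norm_prod]
    exact key z (fun t ht => (min_le_left _ _).trans (hz t ht))
  · intro x hx
    have h1 := (key ((x:ℂ) + y * Complex.I) (fun t _ => (min_le_right _ _).trans (im_le_dist _ _ _ hy0.le))).2
    have h2 : |(∏ j ∈ Finset.range N, (Polynomial.X - Polynomial.C (τ j))).eval x| ≤ ∏ j ∈ Finset.range N, ‖(x:ℂ) + y * Complex.I - τ j‖ := by
      rw [Polynomial.eval_prod, Finset.abs_prod]
      apply Finset.prod_le_prod (fun _ _ => abs_nonneg _)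
      intro j _
      have := norm_xy_mono x (τ j) le_rfl hy0.le
      simp only [Complex.ofReal_zero, zero_mul, add_zero] at this
      rw [← Complex.ofReal_sub, Complex.norm_real] at this
      simpa using this
    refine h2.trans (h1.trans ?_)
    rw [Real.exp_le_exp]
    have := hy x hx
    apply mul_le_mul_of_nonneg_left _ hNp.le
    linarith
end

lemma eval_real (q : Polynomial ℝ) (x : ℝ) : (q.map Complex.ofRealHom).eval (x:ℂ) = ((q.eval x : ℝ) : ℂ) := by
  rw [show (x:ℂ) = Complex.ofRealHom x from rfl, Polynomial.eval_map_apply]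
  rfl

lemma poly_antideriv (f : Polynomial ℝ) : ∃ g : Polynomial ℝ, Polynomial.derivative g = f ∧ g.natDegree ≤ f.natDegree + 1 := by
  refine ⟨∑ i ∈ Finset.range (f.natDegree + 1), Polynomial.C (f.coeff i / (i + 1)) * Polynomial.X ^ (i + 1), ?_, ?_⟩
  · rw [Polynomial.derivative_sum]
    conv_rhs => rw [f.as_sum_range_C_mul_X_pow]
    apply Finset.sum_congr rfl
    intro i _
    rw [Polynomial.derivative_C_mul_X_pow]
    have : ((i:ℝ) + 1) ≠ 0 := by positivity
    push_cast
    rw [div_mul_cancel₀ _ this]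
    try simp
  · apply Polynomial.natDegree_sum_le_of_forall_le
    intro i hi
    refine (Polynomial.natDegree_C_mul_X_pow_le _ _).trans ?_
    have := Finset.mem_range.1 hi
    omega

lemma bestErr_le {A B e : ℝ} (hA : 1 < A) {n : ℕ} (p : Polynomial ℝ) (hp : p.natDegree ≤ n)
    (h : ∀ x ∈ Icc (-A) (-1) ∪ Icc 1 B, |sgn x - p.eval x| ≤ e) : bestErr A B n ≤ e := by
  unfold bestErr
  refine le_trans (b := sSup ((fun x => |sgn x - p.eval x|) '' (Icc (-A) (-1) ∪ Icc 1 B))) (csInf_le ⟨0, ?_⟩ ⟨p, Polynomial.natDegree_le_iff_degree_le.1 hp, rfl⟩) ?_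
  · rintro e ⟨p, _, rfl⟩
    apply Real.sSup_nonneg
    rintro _ ⟨x, _, rfl⟩
    exact abs_nonneg _
  · apply csSup_le
    · exact ⟨_, -1, Or.inl ⟨by linarith, le_rfl⟩, rfl⟩
    · rintro _ ⟨x, hx, rfl⟩
      exact h x hx

lemma poly_ftc (g : Polynomial ℝ) (a b : ℝ) : ∫ x in a..b, (Polynomial.derivative g).eval x = g.eval b - g.eval a := by
  apply intervalIntegral.integral_eq_sub_of_hasDerivAt
  · intro x _
    exact g.hasDerivAt x
  · exact (Polynomial.continuous _).intervalIntegrable _ _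

/-- error of the approximant built from the nonnegative polynomial `f` -/
lemma approx_err {A B M J : ℝ} (hA : 1 < A) (hB : 1 < B) (f : Polynomial ℝ) {n : ℕ} (hf : f.natDegree + 1 ≤ n)
    (hM : ∀ x ∈ Icc (-A) (-1) ∪ Icc 1 B, |f.eval x| ≤ M) (hJ : 0 < J) (hJ' : J ≤ ∫ x in (-1:ℝ)..1, f.eval x) :
    bestErr A B n ≤ 2 * (A + B) * M / J := by
  obtain ⟨g, hg, hgd⟩ := poly_antideriv f
  set I := ∫ x in (-1:ℝ)..1, f.eval x with hI
  have hI0 : 0 < I := hJ.trans_le hJ'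
  have hgI : g.eval 1 - g.eval (-1) = I := by rw [← poly_ftc, hg]
  have hM0 : 0 ≤ M := (abs_nonneg _).trans (hM 1 (Or.inr ⟨le_rfl, hB.le⟩))
  have main : ∀ D : ℝ, |D| ≤ M * (A + B) → |2 / I * D| ≤ 2 * (A + B) * M / J := by
    intro D hD
    rw [abs_mul, abs_of_pos (by positivity)]
    calc 2 / I * |D| ≤ 2 / J * (M * (A + B)) := by gcongr
      _ = _ := by ring
  apply bestErr_le hA (Polynomial.C (2 / I) * (g - Polynomial.C (g.eval (-1))) - 1)
  · refine (Polynomial.natDegree_sub_le _ _).trans ?_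
    simp only [Polynomial.natDegree_one, max_le_iff, zero_le, and_true]
    refine (Polynomial.natDegree_C_mul_le _ _).trans ?_
    rw [Polynomial.natDegree_sub_C]
    omega
  · rintro x (hx | hx)
    · have hb : |∫ t in x..(-1), f.eval t| ≤ M * (A + B) := by
        have := intervalIntegral.norm_integral_le_of_norm_le_const (a := x) (b := -1) (C := M) (f := fun t => f.eval t) (by
          intro t ht
          rw [uIoc_of_le hx.2] at ht
          exact hM t (Or.inl ⟨by linarith [hx.1, ht.1], ht.2⟩))
        refine this.trans ?_
        gcongr
        rw [abs_of_nonneg (by linarith [hx.2])]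
        linarith [hx.1]
      rw [← hg, poly_ftc] at hb
      have := main _ hb
      rw [sgn, if_pos (by linarith [hx.2])]
      convert this using 2
      simp
      ring
    · have hb : |∫ t in (1)..x, f.eval t| ≤ M * (A + B) := by
        have := intervalIntegral.norm_integral_le_of_norm_le_const (a := 1) (b := x) (C := M) (f := fun t => f.eval t) (by
          intro t ht
          rw [uIoc_of_le hx.1] at ht
          exact hM t (Or.inr ⟨ht.1.le, by linarith [hx.2, ht.2]⟩))
        refine this.trans ?_
        gcongr
        rw [abs_of_nonneg (by linarith [hx.1])]
        linarith [hx.2]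
      rw [← hg, poly_ftc] at hb
      have := main _ hb
      rw [sgn, if_neg (by linarith [hx.1]), ← abs_neg]
      convert this using 2
      simp
      rw [← sub_eq_zero]
      have h2 : (g.eval 1 - g.eval (-1)) / I = 1 := by rw [hgI, div_self hI0.ne']
      linear_combination 2 * h2

theorem Pot.lower {A B C γ η : ℝ} {ρ : ℝ → ℝ} {U : ℂ → ℝ} (P : Pot A B C γ η ρ U) {ε : ℝ} (hε : 0 < ε) :
    ∃ K : ℝ, 0 < K ∧ ∃ N : ℕ, 0 < N ∧ ∀ k n : ℕ, 2 * k * N + 1 ≤ n →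
      bestErr A B n ≤ K * Real.exp (-(2 * k * N * (η - 4 * ε))) := by
  have hA := P.hA
  have hB := P.hB
  have hC1 := P.hC1
  have hC2 := P.hC2
  have hd : 0 < min (1 - C) (C + 1) := lt_min (by linarith) (by linarith)
  obtain ⟨N, hN, q, hm, hdeg, -, h1, h2⟩ := P.poly hd hε
  have hNp : (0:ℝ) < N := by exact_mod_cast hN
  have hqC : Real.exp (N * (γ + η - ε)) ≤ |q.eval C| := by
    have := (h1 C (by
      rintro t (ht | ht)
      · rw [← Complex.ofReal_sub, Complex.norm_real, Real.norm_eq_abs, abs_of_nonneg (by linarith [ht.2])]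
        exact (min_le_right _ _).trans (by linarith [ht.2])
      · rw [← Complex.ofReal_sub, Complex.norm_real, Real.norm_eq_abs, abs_of_nonpos (by linarith [ht.1])]
        exact (min_le_left _ _).trans (by linarith [ht.1]))).1
    rw [P.UC] at this
    refine this.trans (le_of_eq ?_)
    rw [eval_real, Complex.norm_real, Real.norm_eq_abs]
  have hlt : Real.exp (N * (γ + η - 2 * ε)) < |q.eval C| := by
    refine lt_of_lt_of_le ?_ hqC
    rw [Real.exp_lt_exp]
    gcongr
    linarith
  have hev : ∀ᶠ x in nhds C, Real.exp (N * (γ + η - 2 * ε)) < |q.eval x| :=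
    (q.continuous.abs.tendsto C).eventually_const_lt hlt
  have hev2 : ∀ᶠ x in nhds C, x < 1 := eventually_lt_nhds hC2
  obtain ⟨r, hr, hball⟩ := Metric.eventually_nhds_iff.1 (hev.and hev2)
  have hIntv : ∀ x ∈ Icc C (C + r / 2), Real.exp (N * (γ + η - 2 * ε)) ≤ |q.eval x| ∧ x < 1 := by
    intro x hx
    have := hball (y := x) (by rw [Real.dist_eq, abs_of_nonneg (by linarith [hx.1])]; linarith [hx.2])
    exact ⟨this.1.le, this.2⟩
  refine ⟨2 * (A + B) / (r / 2), by positivity, N, hN, ?_⟩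
  intro k n hkn
  have hsq : ∀ x, (q ^ (2 * k)).eval x = |q.eval x| ^ (2 * k) := by
    intro x
    rw [Polynomial.eval_pow, pow_mul, pow_mul, sq_abs]
  have hb1 : C + r / 2 ≤ 1 := (hIntv _ ⟨by linarith, le_rfl⟩).2.le
  have hJ : r / 2 * Real.exp (N * (γ + η - 2 * ε)) ^ (2 * k) ≤ ∫ x in (-1:ℝ)..1, (q ^ (2 * k)).eval x := by
    calc r / 2 * Real.exp (N * (γ + η - 2 * ε)) ^ (2 * k) = ∫ x in C..(C + r / 2), Real.exp (N * (γ + η - 2 * ε)) ^ (2 * k) := by simp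
      _ ≤ ∫ x in C..(C + r / 2), (q ^ (2 * k)).eval x := by
        apply intervalIntegral.integral_mono_on (by linarith) (by simp) ((Polynomial.continuous _).intervalIntegrable _ _)
        intro x hx
        rw [hsq]
        gcongr
        exact (hIntv x hx).1
      _ ≤ _ := by
        apply intervalIntegral.integral_mono_interval hC1.le (by linarith) hb1
        · refine Eventually.of_forall fun x => ?_
          simp only [Pi.zero_apply]
          rw [hsq]; positivity
        · exact (Polynomial.continuous _).intervalIntegrable _ _
  have hM : ∀ x ∈ Icc (-A) (-1) ∪ Icc 1 B, |(q ^ (2 * k)).eval x| ≤ Real.exp (N * (γ + 2 * ε)) ^ (2 * k) := by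
    intro x hx
    rw [hsq, abs_of_nonneg (by positivity)]
    gcongr
    have := h2 x (by rcases hx with hx | hx <;> constructor <;> linarith [hx.1, hx.2])
    rwa [P.UI x hx] at this
  have := approx_err hA hB (q ^ (2 * k)) (n := n) (by rw [hm.natDegree_pow, hdeg]; exact hkn) hM (by positivity) hJ
  refine this.trans (le_of_eq ?_)
  rw [← Real.exp_nat_mul, ← Real.exp_nat_mul]
  rw [mul_div_mul_comm, ← Real.exp_sub]
  congr 2
  push_cast; ring


lemma bw_disc {c r : ℝ} {n : ℕ} (q : Polynomial ℂ) (hq : q.natDegree ≤ n) {M : ℝ} (hr : 0 ≤ r)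
    (h : ∀ x ∈ Icc (c - r) (c + r), ‖q.eval (x:ℂ)‖ ≤ M) (w : ℂ) (hw : ‖w‖ ≤ 1) (hw0 : w ≠ 0) :
    ‖w‖ ^ n * ‖q.eval (c + r * ((w + w⁻¹) / 2))‖ ≤ M := by
  set G : ℂ → ℂ := fun w => ∑ i ∈ Finset.range (n + 1), q.coeff i * (c * w + r * ((w ^ 2 + 1) / 2)) ^ i * w ^ (n - i) with hG
  have hGe : ∀ w : ℂ, w ≠ 0 → G w = w ^ n * q.eval (c + r * ((w + w⁻¹) / 2)) := by
    intro w hw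
    rw [Polynomial.eval_eq_sum_range' (Nat.lt_succ_of_le hq), Finset.mul_sum]
    apply Finset.sum_congr rfl
    intro i hi
    have hi' : i ≤ n := by have := Finset.mem_range.1 hi; omega
    have e1 : (c * w + r * ((w ^ 2 + 1) / 2)) = w * (c + r * ((w + w⁻¹) / 2)) := by
      field_simp
    rw [e1, mul_pow]
    have e2 : w ^ n = w ^ i * w ^ (n - i) := by rw [← pow_add]; congr 1; omega
    rw [e2]; ring
  have hd : Differentiable ℂ G := by
    rw [hG]; fun_prop
  rw [← norm_pow, ← norm_mul, ← hGe w hw0]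
  apply Complex.norm_le_of_forall_mem_frontier_norm_le (U := Metric.ball (0:ℂ) 1) Metric.isBounded_ball hd.diffContOnCl
  · intro z hz
    rw [frontier_ball _ one_ne_zero, mem_sphere_zero_iff_norm] at hz
    have hz0 : z ≠ 0 := by intro h; simp [h] at hz
    rw [hGe z hz0, norm_mul, norm_pow, hz, one_pow, one_mul]
    have e : (c:ℂ) + r * ((z + z⁻¹) / 2) = ((c + r * z.re : ℝ) : ℂ) := by
      rw [Complex.inv_eq_conj hz, Complex.add_conj]
      push_cast; ring
    rw [e]
    apply h
    have := Complex.abs_re_le_norm z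
    rw [hz, abs_le] at this
    constructor <;> nlinarith [this.1, this.2]
  · rw [closure_ball _ one_ne_zero]
    simpa using hw

lemma joukowski_pre {ζ : ℂ} {x κ : ℝ} (hx1 : -1 ≤ x) (hx2 : x ≤ 1) (hκ : 0 ≤ κ) (h : 2 * ‖ζ - x‖ ≤ κ ^ 2) :
    ∃ w : ℂ, w ≠ 0 ∧ ‖w‖ ≤ 1 ∧ 1 - κ ≤ ‖w‖ ∧ (w + w⁻¹) / 2 = ζ := by
  obtain ⟨s, hs⟩ := IsAlgClosed.exists_pow_nat_eq (ζ ^ 2 - 1) (n := 2) (by norm_num)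
  have hprod : (ζ + s) * (ζ - s) = 1 := by linear_combination -hs
  have main : ∀ w w' : ℂ, w * w' = 1 → w + w' = 2 * ζ → ‖w‖ ≤ 1 → ∃ w : ℂ, w ≠ 0 ∧ ‖w‖ ≤ 1 ∧ 1 - κ ≤ ‖w‖ ∧ (w + w⁻¹) / 2 = ζ := by
    intro w w' h1 h2 h3
    have hw0 : w ≠ 0 := left_ne_zero_of_mul_eq_one h1
    have hinv : w⁻¹ = w' := by field_simp; exact h1.symm
    refine ⟨w, hw0, h3, ?_, by rw [hinv, h2]; ring⟩
    set y := √(1 - x ^ 2) with hy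
    have hy2 : y ^ 2 = 1 - x ^ 2 := Real.sq_sqrt (by nlinarith)
    have hy2c : (y:ℂ) ^ 2 = 1 - (x:ℂ) ^ 2 := by exact_mod_cast hy2
    have hn1 : ‖(x:ℂ) + y * Complex.I‖ = 1 := by
      rw [Complex.norm_add_mul_I, hy2]; simp
    have hn2 : ‖(x:ℂ) + (-y : ℝ) * Complex.I‖ = 1 := by
      rw [Complex.norm_add_mul_I, neg_sq, hy2]; simp
    have hf : (w - (x + y * Complex.I)) * (w - (x + (-y : ℝ) * Complex.I)) = 2 * (ζ - x) * w := by
      push_cast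
      linear_combination (-(y:ℂ)^2) * Complex.I_sq + hy2c + w * h2 - h1
    have hf' := congrArg norm hf
    rw [norm_mul, norm_mul, norm_mul] at hf'
    have a1 := norm_sub_norm_le ((x:ℂ) + y * Complex.I) w
    have a2 := norm_sub_norm_le ((x:ℂ) + (-y : ℝ) * Complex.I) w
    rw [hn1, norm_sub_rev] at a1
    rw [hn2, norm_sub_rev] at a2
    have h4 : (1 - ‖w‖) * (1 - ‖w‖) ≤ κ ^ 2 := by
      calc (1 - ‖w‖) * (1 - ‖w‖) ≤ ‖w - (x + y * Complex.I)‖ * ‖w - (x + (-y : ℝ) * Complex.I)‖ := by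
            apply mul_le_mul a1 a2 (by linarith) (norm_nonneg _)
        _ = 2 * ‖ζ - x‖ * ‖w‖ := by rw [hf']; simp
        _ ≤ 2 * ‖ζ - x‖ * 1 := by gcongr
        _ ≤ κ ^ 2 := by linarith
    rw [← sq] at h4
    have := abs_le_of_sq_le_sq h4 hκ
    linarith [le_abs_self (1 - ‖w‖)]
  rcases le_total ‖ζ + s‖ 1 with h1 | h1
  · exact main _ _ hprod (by ring) h1
  · refine main (ζ - s) (ζ + s) (by rw [mul_comm]; exact hprod) (by ring) ?_
    have := congrArg norm hprod
    rw [norm_mul, norm_one] at this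
    by_contra! h'
    nlinarith

lemma bw {a b ε : ℝ} (hab : a < b) (hε : 0 < ε) : ∃ δ : ℝ, 0 < δ ∧ ∀ (n : ℕ) (q : Polynomial ℂ) (M : ℝ), q.natDegree ≤ n →
    (∀ x ∈ Icc a b, ‖q.eval (x:ℂ)‖ ≤ M) → ∀ (z : ℂ) (x : ℝ), x ∈ Icc a b → ‖z - x‖ ≤ δ → ‖q.eval z‖ ≤ M * Real.exp (n * ε) := by
  set r := (b - a) / 2 with hr
  set c := (a + b) / 2 with hc
  have hr0 : 0 < r := by rw [hr]; linarith
  set κ := 1 - Real.exp (-ε) with hκ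
  have hκ0 : 0 < κ := by
    have : Real.exp (-ε) < 1 := by rw [Real.exp_lt_one_iff]; linarith
    rw [hκ]; linarith
  refine ⟨κ ^ 2 / 2 * r, by positivity, ?_⟩
  intro n q M hq hM z x hx hz
  have hrc : (r:ℂ) ≠ 0 := by exact_mod_cast hr0.ne'
  have e0 : (z - c) / r - ((x - c) / r : ℝ) = (z - x) / r := by push_cast; field_simp; ring
  obtain ⟨w, hw0, hw1, hw2, hw3⟩ := joukowski_pre (ζ := (z - c) / r) (x := (x - c) / r) (κ := κ)
    (by rw [le_div_iff₀ hr0]; rw [hr, hc]; linarith [hx.1])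
    (by rw [div_le_iff₀ hr0]; rw [hr, hc]; linarith [hx.2]) hκ0.le (by
      rw [e0, norm_div, Complex.norm_real, Real.norm_of_nonneg hr0.le, mul_div_assoc', div_le_iff₀ hr0]
      linarith)
  have := bw_disc (c := c) (r := r) q hq hr0.le (M := M) (by
    have e1 : c - r = a := by rw [hr, hc]; ring
    have e2 : c + r = b := by rw [hr, hc]; ring
    rwa [e1, e2]) w hw1 hw0
  rw [hw3, mul_div_cancel₀ _ hrc, add_sub_cancel] at this
  have h1 : Real.exp (-ε) ≤ ‖w‖ := by rw [hκ] at hw2; linarith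
  have h2 : Real.exp (-ε) ^ n * ‖q.eval z‖ ≤ M := by
    refine le_trans ?_ this
    gcongr
  rw [← Real.exp_nat_mul] at h2
  calc ‖q.eval z‖ = (Real.exp (n * -ε) * ‖q.eval z‖) * Real.exp (n * ε) := by
        rw [mul_right_comm, ← Real.exp_add]; simp
    _ ≤ _ := by gcongr


lemma poly_growth (q : Polynomial ℂ) {m : ℕ} (hq : q.natDegree ≤ m) : ∃ K : ℝ, 0 < K ∧ ∀ z : ℂ, 1 ≤ ‖z‖ → ‖q.eval z‖ ≤ K * ‖z‖ ^ m := by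
  refine ⟨1 + ∑ i ∈ Finset.range (m + 1), ‖q.coeff i‖, by positivity, ?_⟩
  intro z hz
  rw [Polynomial.eval_eq_sum_range' (Nat.lt_succ_of_le hq)]
  refine (norm_sum_le _ _).trans ?_
  rw [add_mul, Finset.sum_mul]
  have : ∑ i ∈ Finset.range (m + 1), ‖q.coeff i * z ^ i‖ ≤ ∑ i ∈ Finset.range (m + 1), ‖q.coeff i‖ * ‖z‖ ^ m := by
    apply Finset.sum_le_sum
    intro i hi
    have hi' : i ≤ m := by have := Finset.mem_range.1 hi; omega
    rw [norm_mul, norm_pow]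
    gcongr
  linarith [pow_nonneg (norm_nonneg z) m]

/-- the abstract maximum principle: compare `f ^ N` with `ω ^ n` off a compact set -/
lemma max_compare {S : Set ℂ} (hS : IsCompact S) (hSne : S.Nonempty) {δ : ℝ} {f ω : Polynomial ℂ} {n N : ℕ}
    (hn : 0 < n) (hN : 0 < N) (hf : f.natDegree ≤ n - 1) {R0 : ℝ}
    (hω : ∀ z : ℂ, R0 ≤ ‖z‖ → (‖z‖ / 2) ^ N ≤ ‖ω.eval z‖) {M m : ℝ} (hM : 0 < M) (hm : 0 < m)
    (hfM : ∀ z, Metric.infDist z S ≤ δ → ‖f.eval z‖ ≤ M)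
    (hωm : ∀ z, δ ≤ Metric.infDist z S → m ≤ ‖ω.eval z‖) (x : ℂ) (hx : δ < Metric.infDist x S) :
    ‖f.eval x‖ ^ N ≤ M ^ N / m ^ n * ‖ω.eval x‖ ^ n := by
  obtain ⟨K, hK, hKf⟩ := poly_growth (f ^ N) (m := (n - 1) * N) (by
    refine Polynomial.natDegree_pow_le.trans ?_
    rw [mul_comm]
    gcongr)
  set K0 := M ^ N / m ^ n with hK0
  have hK00 : 0 < K0 := by positivity
  set R := 1 + |R0| + ‖x‖ + K * 2 ^ (n * N) / K0 with hR
  have hq0 : 0 < K * 2 ^ (n * N) / K0 := by positivity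
  have hR1 : 1 ≤ R := by rw [hR]; linarith [abs_nonneg R0, norm_nonneg x]
  have hR2 : R0 ≤ R := by rw [hR]; linarith [le_abs_self R0, norm_nonneg x]
  have hR3 : ‖x‖ < R := by rw [hR]; linarith [abs_nonneg R0]
  have hR4 : K * 2 ^ (n * N) / K0 ≤ R := by rw [hR]; linarith [abs_nonneg R0, norm_nonneg x]
  have hR0 : 0 < R := by linarith
  have hωne : ∀ z, δ ≤ Metric.infDist z S → ω.eval z ≠ 0 := fun z hz h => by
    have := hωm z hz
    rw [h, norm_zero] at this
    linarith
  set V : Set ℂ := Metric.ball 0 R ∩ {z | δ < Metric.infDist z S} with hV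
  have hVo : IsOpen V := Metric.isOpen_ball.inter (isOpen_lt continuous_const (Metric.continuous_infDist_pt S))
  have hVc : closure V ⊆ {z | ‖z‖ ≤ R} ∩ {z | δ ≤ Metric.infDist z S} := by
    apply closure_minimal
    · rintro z ⟨h1, h2⟩
      exact ⟨(mem_ball_zero_iff.1 h1).le, show δ ≤ Metric.infDist z S from le_of_lt (show δ < Metric.infDist z S from h2)⟩
    · exact (isClosed_le continuous_norm continuous_const).inter (isClosed_le continuous_const (Metric.continuous_infDist_pt S))
  have hxV : x ∈ V := ⟨mem_ball_zero_iff.2 hR3, hx⟩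
  have hdiff : DiffContOnCl ℂ (fun z => (f.eval z) ^ N / (ω.eval z) ^ n) V := by
    apply DifferentiableOn.diffContOnCl
    intro z hz
    apply DifferentiableAt.differentiableWithinAt
    apply DifferentiableAt.div
    · exact (f.differentiableAt).pow _
    · exact (ω.differentiableAt).pow _
    · exact pow_ne_zero _ (hωne z (hVc hz).2)
  have hbd : ‖(f.eval x) ^ N / (ω.eval x) ^ n‖ ≤ K0 := by
    apply Complex.norm_le_of_forall_mem_frontier_norm_le (U := V) (Metric.isBounded_ball.subset inter_subset_left) hdiff _ (subset_closure hxV)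
    intro z hz
    rw [hVo.frontier_eq] at hz
    obtain ⟨hz1, hz2⟩ := hVc hz.1
    have hz1 : ‖z‖ ≤ R := hz1
    have hz2 : δ ≤ Metric.infDist z S := hz2
    have hωz := hωm z hz2
    have hωp : 0 < ‖ω.eval z‖ := hm.trans_le hωz
    rw [norm_div, norm_pow, norm_pow]
    by_cases hzd : Metric.infDist z S ≤ δ
    · have := hfM z hzd
      rw [hK0]
      gcongr
    · have hzR : ‖z‖ = R := by
        apply le_antisymm hz1
        by_contra! h
        exact hz.2 ⟨mem_ball_zero_iff.2 h, not_le.1 hzd⟩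
      rw [div_le_iff₀ (by positivity)]
      have h1 := hKf z (by rw [hzR]; exact hR1)
      rw [Polynomial.eval_pow, norm_pow] at h1
      have h2 := hω z (by rw [hzR]; exact hR2)
      rw [hzR] at h1 h2
      have h3 : K * R ^ ((n - 1) * N) ≤ K0 * ((R / 2) ^ N) ^ n := by
        rw [← pow_mul, div_pow, mul_div_assoc', le_div_iff₀ (by positivity)]
        have e : R ^ (N * n) = R ^ ((n - 1) * N) * R ^ N := by
          rw [← pow_add]; congr 1
          obtain ⟨k, rfl⟩ := Nat.exists_eq_add_of_lt hn
          simp; ring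
        rw [e, mul_comm N n]
        have h4 : K * 2 ^ (n * N) ≤ K0 * R ^ N := by
          rw [div_le_iff₀ hK00] at hR4
          have : R ≤ R ^ N := le_self_pow₀ hR1 hN.ne'
          nlinarith
        calc K * R ^ ((n - 1) * N) * 2 ^ (n * N) = (K * 2 ^ (n * N)) * R ^ ((n - 1) * N) := by ring
          _ ≤ (K0 * R ^ N) * R ^ ((n - 1) * N) := by gcongr
          _ = _ := by ring
      calc ‖f.eval z‖ ^ N ≤ K0 * ((R / 2) ^ N) ^ n := h1.trans h3
        _ ≤ _ := by gcongr
  rw [norm_div, norm_pow, norm_pow, div_le_iff₀] at hbd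
  · exact hbd
  · have := hωm x hx.le
    have : 0 < ‖ω.eval x‖ := hm.trans_le this
    positivity

theorem Pot.upper {A B C γ η : ℝ} {ρ : ℝ → ℝ} {U : ℂ → ℝ} (P : Pot A B C γ η ρ U) {ε : ℝ} (hε : 0 < ε) :
    ∃ K : ℝ, 1 ≤ K ∧ ∀ (n : ℕ) (p : Polynomial ℝ) (L : ℝ), 0 < n → p.natDegree ≤ n → 0 < L →
      (∀ x ∈ Icc (-A) (-1) ∪ Icc 1 B, |sgn x - p.eval x| ≤ L) → 1 ≤ L * (K * Real.exp (n * (η + 4 * ε))) := by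
  have hA := P.hA
  have hB := P.hB
  have hη := P.eta0
  obtain ⟨δ1, hδ1, H1⟩ := bw (a := -A) (b := -1) (by linarith) hε
  obtain ⟨δ2, hδ2, H2⟩ := bw (a := 1) (b := B) hB hε
  set δ := min δ1 δ2 / 2 with hδd
  have hδ : 0 < δ := by have := lt_min hδ1 hδ2; positivity
  have hδ1' : 2 * δ ≤ δ1 := by rw [hδd]; linarith [min_le_left δ1 δ2]
  have hδ2' : 2 * δ ≤ δ2 := by rw [hδd]; linarith [min_le_right δ1 δ2]
  obtain ⟨N, hN, q, hm, hdeg, hgrow, hq1, hq2⟩ := P.poly hδ hε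
  have hNp : (0:ℝ) < N := by exact_mod_cast hN
  refine ⟨1 + 1 / δ, by linarith [one_div_pos.2 hδ], ?_⟩
  intro n p L hn hp hL h
  have hnp : (0:ℝ) < n := by exact_mod_cast hn
  set S : Set ℂ := (fun t : ℝ => (t:ℂ)) '' (Icc (-A) (-1) ∪ Icc 1 B) with hS
  have hSc : IsCompact S := (isCompact_Icc.union isCompact_Icc).image Complex.continuous_ofReal
  have hSne : S.Nonempty := ⟨_, 1, Or.inr ⟨le_rfl, hB.le⟩, rfl⟩
  set pc := p.map Complex.ofRealHom with hpc
  have hpcd : pc.natDegree ≤ n := (Polynomial.natDegree_map_le).trans hp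
  set f := Polynomial.derivative pc with hf
  -- bound for the derivative near the set
  have hder : ∀ z, Metric.infDist z S ≤ δ → ‖f.eval z‖ ≤ L * Real.exp (n * ε) / δ := by
    intro z hz
    obtain ⟨s, ⟨t, ht, rfl⟩, hzt⟩ := hSc.exists_infDist_eq_dist hSne z
    rw [hzt, Complex.dist_eq] at hz
    have key : ∀ σ : ℝ, (∀ w : ℂ, ‖w - t‖ ≤ 2 * δ → ‖(pc - Polynomial.C (σ:ℂ)).eval w‖ ≤ L * Real.exp (n * ε)) →
        ‖f.eval z‖ ≤ L * Real.exp (n * ε) / δ := by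
      intro σ hσ
      have e : f.eval z = deriv (fun w => (pc - Polynomial.C (σ:ℂ)).eval w) z := by
        rw [Polynomial.deriv]
        simp [hf]
      rw [e]
      apply Complex.norm_deriv_le_of_forall_mem_sphere_norm_le hδ
      · exact (Polynomial.differentiable _).diffContOnCl
      · intro w hw
        apply hσ
        rw [mem_sphere_iff_norm] at hw
        calc ‖w - t‖ = ‖(w - z) + (z - t)‖ := by ring_nf
          _ ≤ ‖w - z‖ + ‖z - t‖ := norm_add_le _ _
          _ ≤ 2 * δ := by linarith
    have hdd : ∀ σ : ℝ, (pc - Polynomial.C (σ:ℂ)).natDegree ≤ n := by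
      intro σ
      rw [Polynomial.natDegree_sub_C]; exact hpcd
    have hev : ∀ σ x : ℝ, ‖(pc - Polynomial.C (σ:ℂ)).eval (x:ℂ)‖ = |σ - p.eval x| := by
      intro σ x
      rw [Polynomial.eval_sub, Polynomial.eval_C, hpc, eval_real, ← Complex.ofReal_sub, Complex.norm_real, Real.norm_eq_abs, abs_sub_comm]
    rcases ht with ht | ht
    · apply key (-1)
      intro w hw
      apply H1 n _ L (hdd _) _ w t ht (hw.trans hδ1')
      intro x hx
      rw [hev]
      have := h x (Or.inl hx)
      rwa [sgn, if_pos (by linarith [hx.2])] at this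
    · apply key 1
      intro w hw
      apply H2 n _ L (hdd _) _ w t ht (hw.trans hδ2')
      intro x hx
      rw [hev]
      have := h x (Or.inr hx)
      rwa [sgn, if_neg (by linarith [hx.1])] at this
  have hdist : ∀ z, δ ≤ Metric.infDist z S → ∀ t ∈ Icc (-A) (-1) ∪ Icc 1 B, δ ≤ ‖z - (t:ℝ)‖ := by
    intro z hz t ht
    refine hz.trans ?_
    rw [← Complex.dist_eq]
    exact Metric.infDist_le_dist_of_mem ⟨t, ht, rfl⟩
  have hωm : ∀ z, δ ≤ Metric.infDist z S → Real.exp (N * (γ - ε)) ≤ ‖(q.map Complex.ofRealHom).eval z‖ := by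
    intro z hz
    refine le_trans ?_ (hq1 z (hdist z hz)).1
    rw [Real.exp_le_exp]
    have := P.ge hδ (hdist z hz)
    gcongr
  have hpt : ∀ x ∈ Icc (-1:ℝ) 1, |(Polynomial.derivative p).eval x| ≤ L / δ * Real.exp (n * (η + 4 * ε)) := by
    intro x hx
    have e : |(Polynomial.derivative p).eval x| = ‖f.eval (x:ℂ)‖ := by
      rw [hf, hpc, Polynomial.derivative_map, eval_real, Complex.norm_real, Real.norm_eq_abs]
    rw [e]
    by_cases hd : Metric.infDist (x:ℂ) S ≤ δ
    · refine (hder _ hd).trans ?_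
      rw [mul_div_right_comm]
      gcongr
      linarith
    · have := max_compare hSc hSne hn hN (f := f) ((Polynomial.natDegree_derivative_le _).trans (by omega)) hgrow
        (by positivity) (Real.exp_pos _) hder hωm x (not_le.1 hd)
      rw [← pow_le_pow_iff_left₀ (norm_nonneg _) (by positivity) hN.ne']
      refine this.trans ?_
      have h2 : ‖(q.map Complex.ofRealHom).eval (x:ℂ)‖ ≤ Real.exp (N * (γ + η + 2 * ε)) := by
        rw [eval_real, Complex.norm_real, Real.norm_eq_abs]
        have hxI : x ∈ Icc (-A) B := ⟨by linarith [hx.1], by linarith [hx.2]⟩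
        refine (hq2 x hxI).trans ?_
        rw [Real.exp_le_exp]
        have := P.Ule x hxI
        gcongr
      calc _ ≤ (L * Real.exp (n * ε) / δ) ^ N / Real.exp (N * (γ - ε)) ^ n * Real.exp (N * (γ + η + 2 * ε)) ^ n := by gcongr
        _ = (L / δ * Real.exp (n * (η + 4 * ε))) ^ N := by
          rw [mul_div_right_comm, mul_pow, mul_pow, mul_div_assoc, mul_assoc]
          congr 1
          rw [← Real.exp_nat_mul, ← Real.exp_nat_mul, ← Real.exp_nat_mul, ← Real.exp_nat_mul, ← Real.exp_sub, ← Real.exp_add]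
          congr 1
          ring
  have hint : |∫ x in (-1:ℝ)..1, (Polynomial.derivative p).eval x| ≤ L / δ * Real.exp (n * (η + 4 * ε)) * |1 - (-1)| := by
    rw [← Real.norm_eq_abs]
    apply intervalIntegral.norm_integral_le_of_norm_le_const
    intro x hx
    rw [uIoc_of_le (by norm_num)] at hx
    exact hpt x ⟨hx.1.le, hx.2⟩
  rw [poly_ftc] at hint
  have a1 := h 1 (Or.inr ⟨le_rfl, hB.le⟩)
  have a2 := h (-1) (Or.inl ⟨by linarith, le_rfl⟩)
  rw [sgn, if_neg (by norm_num), abs_le] at a1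
  rw [sgn, if_pos (by norm_num), abs_le] at a2
  have a3 := le_abs_self (p.eval 1 - p.eval (-1))
  rw [show |(1:ℝ) - (-1)| = 2 by norm_num] at hint
  have a4 : 1 ≤ L + L / δ * Real.exp (n * (η + 4 * ε)) := by linarith [a1.2, a2.1]
  have a5 : 1 ≤ Real.exp (n * (η + 4 * ε)) := Real.one_le_exp (by positivity)
  calc 1 ≤ L + L / δ * Real.exp (n * (η + 4 * ε)) := a4
    _ ≤ L * Real.exp (n * (η + 4 * ε)) + L / δ * Real.exp (n * (η + 4 * ε)) := by nlinarith
    _ = _ := by ring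


lemma bestErr_ge {A B κ : ℝ} {n : ℕ} (hκ : 0 < κ)
    (h : ∀ (p : Polynomial ℝ) (L : ℝ), p.natDegree ≤ n → 0 < L →
      (∀ x ∈ Icc (-A) (-1) ∪ Icc 1 B, |sgn x - p.eval x| ≤ L) → 1 ≤ L * κ) : 1 / κ ≤ bestErr A B n := by
  unfold bestErr
  apply le_csInf
  · exact ⟨_, 0, by simp, rfl⟩
  · rintro e ⟨p, hp, rfl⟩
    set E := sSup ((fun x => |sgn x - p.eval x|) '' (Icc (-A) (-1) ∪ Icc 1 B)) with hE
    have hE0 : 0 ≤ E := by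
      apply Real.sSup_nonneg
      rintro _ ⟨x, _, rfl⟩
      exact abs_nonneg _
    have hbdd : BddAbove ((fun x => |sgn x - p.eval x|) '' (Icc (-A) (-1) ∪ Icc 1 B)) := by
      obtain ⟨M, hM⟩ := (isCompact_Icc.union isCompact_Icc : IsCompact (Icc (-A) (-1) ∪ Icc 1 B)).exists_bound_of_continuousOn p.continuous.continuousOn
      refine ⟨1 + M, ?_⟩
      rintro _ ⟨x, hx, rfl⟩
      have h1 : |sgn x| ≤ 1 := by unfold sgn; split_ifs <;> simp
      have h2 := hM x hx
      rw [Real.norm_eq_abs] at h2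
      simp only
      have := abs_sub (sgn x) (p.eval x)
      linarith
    apply le_of_forall_pos_le_add
    intro τ hτ
    rw [div_le_iff₀ hκ]
    apply h p (E + τ) (Polynomial.natDegree_le_iff_degree_le.2 hp) (by linarith)
    intro x hx
    have := le_csSup hbdd ⟨x, hx, rfl⟩
    simp only at this
    linarith

lemma Pot.both {A B C γ η : ℝ} {ρ : ℝ → ℝ} {U : ℂ → ℝ} (P : Pot A B C γ η ρ U) {ε : ℝ} (hε : 0 < ε) :
    ∃ c : ℝ, ∀ n : ℕ, 0 < n → n * (η - 4 * ε) - c ≤ Real.log (1 / bestErr A B n) ∧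
      Real.log (1 / bestErr A B n) ≤ n * (η + 4 * ε) + c := by
  obtain ⟨K1, hK1, H1⟩ := P.upper hε
  obtain ⟨K2, hK2, N, hN, H2⟩ := P.lower hε
  have hK1' : 0 < K1 := by linarith
  have hNp : (0:ℝ) < N := by exact_mod_cast hN
  refine ⟨|Real.log K1| + |Real.log K2| + 2 * N * |η - 4 * ε|, ?_⟩
  intro n hn
  have hκ : 0 < K1 * Real.exp (n * (η + 4 * ε)) := by positivity
  have hge : 1 / (K1 * Real.exp (n * (η + 4 * ε))) ≤ bestErr A B n :=
    bestErr_ge hκ (fun p L hp hL h => H1 n p L hn hp hL h)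
  have hpos : 0 < bestErr A B n := lt_of_lt_of_le (by positivity) hge
  constructor
  · set k := (n - 1) / (2 * N) with hk
    have e1 : 2 * N * k + (n - 1) % (2 * N) = n - 1 := Nat.div_add_mod _ _
    have e2 : (n - 1) % (2 * N) < 2 * N := Nat.mod_lt _ (by omega)
    have hk1 : 2 * k * N + 1 ≤ n := by
      have : 2 * k * N = 2 * N * k := by ring
      omega
    have hk2 : n ≤ 2 * k * N + 2 * N := by
      have : 2 * k * N = 2 * N * k := by ring
      omega
    have hle := H2 k n hk1
    have hlog := Real.log_le_log hpos hle
    rw [Real.log_mul hK2.ne' (Real.exp_pos _).ne', Real.log_exp] at hlog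
    rw [one_div, Real.log_inv]
    have h1 : (2 * k * N + 1 : ℝ) ≤ n := by exact_mod_cast hk1
    have h2 : (n : ℝ) ≤ 2 * k * N + 2 * N := by exact_mod_cast hk2
    have h3 : (n - 2 * k * N : ℝ) * (η - 4 * ε) ≤ 2 * N * |η - 4 * ε| := by
      calc (n - 2 * k * N : ℝ) * (η - 4 * ε) ≤ (n - 2 * k * N : ℝ) * |η - 4 * ε| := by
            apply mul_le_mul_of_nonneg_left (le_abs_self _) (by linarith)
        _ ≤ _ := by
            apply mul_le_mul_of_nonneg_right (by linarith) (abs_nonneg _)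
    linarith [le_abs_self (Real.log K2), abs_nonneg (Real.log K1)]
  · have hlog := Real.log_le_log (by positivity) hge
    rw [one_div, Real.log_inv, Real.log_mul hK1'.ne' (Real.exp_pos _).ne', Real.log_exp] at hlog
    rw [one_div, Real.log_inv]
    have h3 : 0 ≤ 2 * N * |η - 4 * ε| := by positivity
    linarith [le_abs_self (Real.log K1), abs_nonneg (Real.log K2)]

theorem log_error_asymptotics (A B : ℝ) (hA : 1 < A) (hB : 1 < B) :
    Tendsto (fun n : ℕ => Real.log (1 / bestErr A B n) / n) atTop (nhds (eta A B)) := by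
  obtain ⟨γ, ρ, U, P⟩ := pot_exists hA hB
  rw [Metric.tendsto_atTop]
  intro ε hε
  obtain ⟨c, hc⟩ := P.both (ε := ε / 8) (by positivity)
  obtain ⟨n0, hn0⟩ := exists_nat_gt (2 * |c| / ε)
  refine ⟨n0 + 1, fun n hn => ?_⟩
  have hnp : 0 < n := by omega
  have hnr : (0:ℝ) < n := by exact_mod_cast hnp
  have hn1 : (n0:ℝ) < n := by exact_mod_cast (show n0 < n by omega)
  obtain ⟨h1, h2⟩ := hc n hnp
  have h3 : 2 * |c| < n * ε := by
    rw [div_lt_iff₀ hε] at hn0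
    nlinarith
  have h4 := le_abs_self c
  rw [Real.dist_eq, abs_lt]
  constructor
  · rw [lt_sub_iff_add_lt, lt_div_iff₀ hnr]
    nlinarith
  · rw [sub_lt_iff_lt_add, div_lt_iff₀ hnr]
    nlinarith
end

section
/- Let P₁ and P₂ be real polynomials of the same degree n ≥ 2 with positive leading coefficients, such that each of P₁ and P₂ has all its critical points real and simple (i.e., P₁′ and P₂′ each have n−1 distinct real roots). List the critical points in increasing order as c₁ < c₂ < … < c_{n−1} and c′₁ < c′₂ < … < c′_{n−1}. If P₁(c_j) = P₂(c′_j) for all 1 ≤ j ≤ n−1, then there exist c > 0 and b ∈ ℝ such that P₁(z) = P₂(cz + b) for all z. -/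
/-- Monotone transport between two increasing pieces. -/
theorem transport_exists (p q p' q' : ℝ → ℝ) (a b a' b' : ℝ) (hab' : a' < b')
    (hp : ∀ x, HasDerivAt p (p' x) x) (hq : ∀ x, HasDerivAt q (q' x) x)
    (hp0 : ∀ x ∈ Set.Ioo a b, 0 < p' x) (hq0 : ∀ x ∈ Set.Ioo a' b', 0 < q' x)
    (ha : p a = q a') (hb : p b = q b') :
    ∃ φ : ℝ → ℝ, Continuous φ ∧ ∀ x ∈ Set.Ioo a b, φ x ∈ Set.Ioo a' b' ∧
      HasDerivAt φ (p' x / q' (φ x)) x := by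
  have hqc : Continuous q := continuous_iff_continuousAt.2 fun x => (hq x).continuousAt
  have hpc : Continuous p := continuous_iff_continuousAt.2 fun x => (hp x).continuousAt
  have hqm : StrictMonoOn q (Set.Icc a' b') := by
    apply strictMonoOn_of_deriv_pos (convex_Icc _ _) hqc.continuousOn
    intro x hx
    rw [interior_Icc] at hx
    rw [(hq x).deriv]; exact hq0 x hx
  have hpm : StrictMonoOn p (Set.Icc a b) := by
    apply strictMonoOn_of_deriv_pos (convex_Icc _ _) hpc.continuousOn
    intro x hx
    rw [interior_Icc] at hx
    rw [(hp x).deriv]; exact hp0 x hx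
  set k : ℝ → ℝ := fun y => max a' (min b' y) with hk
  have hkm : Monotone k := fun x y h => max_le_max le_rfl (min_le_min le_rfl h)
  have hkmem : ∀ y, k y ∈ Set.Icc a' b' := fun y =>
    ⟨le_max_left _ _, max_le hab'.le (min_le_left _ _)⟩
  have hkid : ∀ y ∈ Set.Icc a' b', k y = y := by
    intro y hy; simp only [hk]; rw [min_eq_right hy.2, max_eq_right hy.1]
  have hklip : ∀ x y, x ≤ y → x - k x ≤ y - k y := by
    intro x y h
    simp only [hk]
    rcases max_cases a' (min b' x) with h1 | h1 <;> rcases max_cases a' (min b' y) with h2 | h2 <;>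
    rcases min_cases b' x with h3 | h3 <;> rcases min_cases b' y with h4 | h4 <;> linarith
  set h : ℝ → ℝ := fun y => q (k y) + (y - k y) with hh
  have hkc : Continuous k := by fun_prop
  have hhc : Continuous h := by fun_prop
  have hhm : StrictMono h := by
    intro x y hxy
    simp only [hh]
    rcases (hkm hxy.le).lt_or_eq with h1 | h1
    · have := hqm (hkmem x) (hkmem y) h1
      have := hklip x y hxy.le
      linarith
    · rw [h1]; linarith
  have hsurj : Function.Surjective h := by
    apply hhc.surjective
    · apply Filter.tendsto_atTop_mono (f := fun y => (q a' - b') + y)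
      · intro y
        have h1 := hqm.monotoneOn (Set.left_mem_Icc.2 hab'.le) (hkmem y) (hkmem y).1
        have := (hkmem y).2
        simp only [hh]; linarith
      · exact Filter.tendsto_atTop_add_const_left _ _ Filter.tendsto_id
    · apply Filter.tendsto_atBot_mono (f := fun y => (q b' - a') + y)
      · intro y
        have h1 := hqm.monotoneOn (hkmem y) (Set.right_mem_Icc.2 hab'.le) (hkmem y).2
        have := (hkmem y).1
        simp only [hh]; linarith
      · exact Filter.tendsto_atBot_add_const_left _ _ Filter.tendsto_id
  let e := hhm.orderIsoOfSurjective h hsurj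
  have hgc : Continuous e.symm := e.symm.continuous
  have heg : ∀ z, h (e.symm z) = z := fun z => e.apply_symm_apply z
  refine ⟨fun x => e.symm (p x), hgc.comp hpc, ?_⟩
  intro x hx
  have hxI : x ∈ Set.Icc a b := ⟨hx.1.le, hx.2.le⟩
  have hab : a ≤ b := (hx.1.trans hx.2).le
  have hmem : e.symm (p x) ∈ Set.Ioo a' b' := by
    constructor
    · rw [← hhm.lt_iff_lt, heg]
      have : h a' = q a' := by simp [hh, hkid a' (Set.left_mem_Icc.2 hab'.le)]
      rw [this, ← ha]; exact hpm (Set.left_mem_Icc.2 hab) hxI hx.1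
    · rw [← hhm.lt_iff_lt, heg]
      have : h b' = q b' := by simp [hh, hkid b' (Set.right_mem_Icc.2 hab'.le)]
      rw [this, ← hb]; exact hpm hxI (Set.right_mem_Icc.2 hab) hx.2
  refine ⟨hmem, ?_⟩
  have hd : HasDerivAt h (q' (e.symm (p x))) (e.symm (p x)) := by
    apply (hq _).congr_of_eventuallyEq
    filter_upwards [Ioo_mem_nhds hmem.1 hmem.2] with y hy
    simp [hh, hkid y ⟨hy.1.le, hy.2.le⟩]
  have h2 : HasDerivAt e.symm (q' (e.symm (p x)))⁻¹ (p x) :=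
    HasDerivAt.of_local_left_inverse hgc.continuousAt hd (hq0 _ hmem).ne'
      (Filter.Eventually.of_forall heg)
  have h3 := h2.comp x (hp x)
  rw [div_eq_inv_mul]
  exact h3

theorem interval_step {N : ℕ} (c c' : Fin N → ℝ) (A : ℝ) (hA : A ≠ 0) (p q E : ℝ → ℝ)
    (i j : Fin N) (hij : c i < c j) (hij' : c' i < c' j)
    (hp : ∀ x, HasDerivAt p (A * ∏ k, (x - c k)) x)
    (hq : ∀ x, HasDerivAt q (A * ∏ k, (x - c' k)) x)
    (hE : ∀ x, HasDerivAt E (-∑ l, (c' l - c l) * (A * ∏ k ∈ Finset.univ.erase l, (x - c k))) x)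
    (hi : p (c i) = q (c' i)) (hj : p (c j) = q (c' j))
    (hr : ∀ x ∈ Set.Ioo (c i) (c j), ∀ y ∈ Set.Ioo (c' i) (c' j), ∀ k, 0 < (y - c' k) / (x - c k))
    (hp0 : ∀ x ∈ Set.Ioo (c i) (c j), 0 < A * ∏ k, (x - c k))
    (hq0 : ∀ x ∈ Set.Ioo (c' i) (c' j), 0 < A * ∏ k, (x - c' k)) :
    E (c i) ≤ E (c j) := by
  obtain ⟨φ, hφc, hφ⟩ := transport_exists p q _ _ _ _ _ _ hij' hp hq hp0 hq0 hi hj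
  have hEc : Continuous E := continuous_iff_continuousAt.2 fun x => (hE x).continuousAt
  set Ψ : ℝ → ℝ := fun x => (φ x - x) * (A * ∏ k, (x - c k)) + E x with hΨ
  have hΨc : Continuous Ψ := by fun_prop
  have hder : ∀ x ∈ Set.Ioo (c i) (c j), ∃ D, 0 ≤ D ∧ HasDerivAt Ψ D x := by
    intro x hx
    obtain ⟨hm, hd⟩ := hφ x hx
    have hprod : HasDerivAt (fun x => ∏ k, (x - c k))
        (∑ l, ∏ k ∈ Finset.univ.erase l, (x - c k)) x := by
      have := HasDerivAt.fun_finsetProd (u := Finset.univ) (f := fun k (x : ℝ) => x - c k)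
        (f' := fun _ => 1) (x := x) (fun k _ => (hasDerivAt_id x).sub_const (c k))
      simpa using this
    have hD := ((hd.sub (hasDerivAt_id x)).mul (hprod.const_mul A)).add (hE x)
    refine ⟨_, ?_, hD⟩
    have hne : ∀ k, x - c k ≠ 0 := by
      intro k h0
      have := hr x hx _ hm k
      rw [h0, div_zero] at this
      exact lt_irrefl _ this
    have herase : ∀ l, ∏ k ∈ Finset.univ.erase l, (x - c k) = (∏ k, (x - c k)) / (x - c l) := by
      intro l
      rw [eq_div_iff (hne l), Finset.prod_erase_mul _ _ (Finset.mem_univ l)]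
    set Pr := ∏ k, (x - c k) with hPr
    have hlog : 0 ≤ (A * Pr / (A * ∏ k, (φ x - c' k)) - 1)
        + ∑ k, ((φ x - c' k) / (x - c k) - 1) := by
      have hpos : 0 < A * Pr / (A * ∏ k, (φ x - c' k)) := div_pos (hp0 x hx) (hq0 _ hm)
      have h1 := Real.log_le_sub_one_of_pos hpos
      have h2 : ∑ k, Real.log ((φ x - c' k) / (x - c k)) ≤ ∑ k, ((φ x - c' k) / (x - c k) - 1) :=
        Finset.sum_le_sum fun k _ => Real.log_le_sub_one_of_pos (hr x hx _ hm k)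
      have h3 : Real.log (A * Pr / (A * ∏ k, (φ x - c' k)))
          + ∑ k, Real.log ((φ x - c' k) / (x - c k)) = 0 := by
        rw [← Real.log_prod (fun k _ => (hr x hx _ hm k).ne'), ← Real.log_mul hpos.ne'
          (Finset.prod_ne_zero_iff.2 fun k _ => (hr x hx _ hm k).ne'), Finset.prod_div_distrib]
        have hq1 := (hq0 _ hm).ne'
        have hp1 := (hp0 _ hx).ne'
        rw [← hPr] at hp1 ⊢
        have e1 : Pr ≠ 0 := right_ne_zero_of_mul hp1
        have e2 := right_ne_zero_of_mul hq1
        have : A * Pr / (A * ∏ k, (φ x - c' k)) * ((∏ k, (φ x - c' k)) / Pr) = 1 := by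
          field_simp
        rw [this, Real.log_one]
      linarith
    have hkey := mul_nonneg (hp0 x hx).le hlog
    rw [← hPr] at hkey
    simp_rw [herase]
    refine hkey.trans (le_of_eq (Eq.symm ?_))
    simp only [Pi.sub_apply, id, mul_add, Finset.mul_sum]
    rw [add_assoc]
    congr 1
    · ring
    · rw [← sub_eq_add_neg, ← Finset.sum_sub_distrib]
      refine Finset.sum_congr rfl fun k _ => ?_
      have := hne k
      field_simp
      ring
  have hmono : MonotoneOn Ψ (Set.Icc (c i) (c j)) := by
    apply monotoneOn_of_deriv_nonneg (convex_Icc _ _) hΨc.continuousOn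
    · rw [interior_Icc]; intro x hx
      obtain ⟨D, _, hD⟩ := hder x hx
      exact hD.differentiableAt.differentiableWithinAt
    · rw [interior_Icc]; intro x hx
      obtain ⟨D, h0, hD⟩ := hder x hx
      rw [hD.deriv]; exact h0
  have hfin := hmono (Set.left_mem_Icc.2 hij.le) (Set.right_mem_Icc.2 hij.le) hij.le
  have z : ∀ l, ∏ k, (c l - c k) = 0 := fun l =>
    Finset.prod_eq_zero (Finset.mem_univ l) (sub_self _)
  simpa [hΨ, z] using hfin

theorem sum_nonneg_aux {M : ℕ} (c c' : Fin (M + 2) → ℝ) (hc : StrictMono c) (hc' : StrictMono c')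
    (A : ℝ) (hA : 0 < A) (p q : ℝ → ℝ)
    (hp : ∀ x, HasDerivAt p (A * ∏ k, (x - c k)) x)
    (hq : ∀ x, HasDerivAt q (A * ∏ k, (x - c' k)) x)
    (hpq : ∀ i, p (c i) = q (c' i)) (hsum : ∑ i, (c' i - c i) = 0) :
    0 ≤ ∑ i, (c' i - c i) * c i := by
  classical
  open Polynomial in
  set e : ℝ[X] := -∑ l, C (c' l - c l) * (C A * ∏ k ∈ Finset.univ.erase l, (X - C (c k))) with he
  have heval : ∀ x, e.eval x
      = -∑ l, (c' l - c l) * (A * ∏ k ∈ Finset.univ.erase l, (x - c k)) := by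
    intro x
    simp [he, Polynomial.eval_finsetSum, Polynomial.eval_prod]
  set E : ℝ → ℝ := fun x => ∫ t in (0:ℝ)..x, e.eval t with hEdef
  have hE' : ∀ x, HasDerivAt E (e.eval x) x := fun x =>
    e.continuous.integral_hasStrictDerivAt 0 x |>.hasDerivAt
  have hE : ∀ x, HasDerivAt E
      (-∑ l, (c' l - c l) * (A * ∏ k ∈ Finset.univ.erase l, (x - c k))) x := fun x => by
    rw [← heval]; exact hE' x
  have hlt : ∀ j : Fin (M + 1), c j.castSucc < c j.succ := fun j => hc j.castSucc_lt_succ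
  have hlt' : ∀ j : Fin (M + 1), c' j.castSucc < c' j.succ := fun j => hc' j.castSucc_lt_succ
  have hmvt : ∀ j : Fin (M + 1), ∃ x ∈ Set.Ioo (c j.castSucc) (c j.succ),
      e.eval x = (E (c j.succ) - E (c j.castSucc)) / (c j.succ - c j.castSucc) := fun j =>
    exists_hasDerivAt_eq_slope E _ (hlt j)
      (continuous_iff_continuousAt.2 fun x => (hE' x).continuousAt).continuousOn
      (fun x _ => hE' x)
  choose x hx hxe using hmvt
  have hxm : StrictMono x := by
    intro i j hij
    have : c i.succ ≤ c j.castSucc := hc.monotone (by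
      rw [Fin.le_def]; simp; exact hij)
    linarith [(hx i).2, (hx j).1]
  -- signs
  have key : ∀ (d : Fin (M + 2) → ℝ), StrictMono d → ∀ j : Fin (M + 1),
      ∀ y ∈ Set.Ioo (d j.castSucc) (d j.succ),
      (∏ k, (y - d k)) * ∏ k ∈ Finset.univ.erase j, (x j - x k) < 0 := by
    intro d hd j y hy
    rw [Fin.prod_univ_succ, ← Finset.mul_prod_erase Finset.univ _ (Finset.mem_univ j)]
    have h1 : 0 < ∏ k ∈ Finset.univ.erase j, ((y - d k.succ) * (x j - x k)) := by
      apply Finset.prod_pos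
      intro k hk
      rcases lt_or_gt_of_ne (Finset.ne_of_mem_erase hk) with h | h
      · have a1 := hxm h
        have : d k.succ ≤ d j.castSucc := hd.monotone (by
          rw [Fin.le_def]; simp; exact h)
        exact mul_pos (by linarith [hy.1]) (by linarith)
      · have a1 := hxm h
        have : d j.succ < d k.succ := hd (by simpa using h)
        exact mul_pos_of_neg_of_neg (by linarith [hy.2]) (by linarith)
    rw [Finset.prod_mul_distrib] at h1
    have h2 : 0 < y - d 0 := by
      have : d 0 ≤ d j.castSucc := hd.monotone (Fin.zero_le _)
      linarith [hy.1]
    have h3 : y - d j.succ < 0 := by linarith [hy.2]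
    have := mul_neg_of_neg_of_pos (mul_neg_of_pos_of_neg h2 h3) h1
    linarith
  have hratio : ∀ j : Fin (M + 1), ∀ u ∈ Set.Ioo (c j.castSucc) (c j.succ),
      ∀ y ∈ Set.Ioo (c' j.castSucc) (c' j.succ), ∀ k, 0 < (y - c' k) / (u - c k) := by
    intro j u hu y hy k
    rcases le_or_gt k j.castSucc with h | h
    · have a1 := hc.monotone h
      have a2 := hc'.monotone h
      exact div_pos (by linarith [hy.1]) (by linarith [hu.1])
    · have h' : j.succ ≤ k := by
        rw [Fin.lt_def] at h; rw [Fin.le_def]; simp at h ⊢; omega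
      have a1 := hc.monotone h'
      have a2 := hc'.monotone h'
      exact div_pos_of_neg_of_neg (by linarith [hy.2]) (by linarith [hu.2])
  have hterm : ∀ j : Fin (M + 1),
      e.eval (x j) / ∏ k ∈ Finset.univ.erase j, (x j - x k) ≤ 0 := by
    intro j
    set w := ∏ k ∈ Finset.univ.erase j, (x j - x k) with hw
    have hgap : 0 < c j.succ - c j.castSucc := sub_pos.2 (hlt j)
    rw [hxe j]
    rcases lt_trichotomy w 0 with hw0 | hw0 | hw0
    · have hst := interval_step c c' A hA.ne' p q E _ _ (hlt j) (hlt' j) hp hq hE (hpq _) (hpq _)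
        (hratio j)
        (fun y hy => mul_pos hA (pos_of_mul_neg_left (key c hc j y hy) hw0.le))
        (fun y hy => mul_pos hA (pos_of_mul_neg_left (key c' hc' j y hy) hw0.le))
      exact div_nonpos_of_nonneg_of_nonpos (div_nonneg (sub_nonneg.2 hst) hgap.le) hw0.le
    · rw [hw0]; simp
    · have hst := interval_step c c' (-A) (neg_ne_zero.2 hA.ne') (fun x => - p x) (fun x => - q x)
        (fun x => - E x) _ _ (hlt j) (hlt' j)
        (fun x => by simpa using (hp x).fun_neg) (fun x => by simpa using (hq x).fun_neg)
        (fun x => by simpa using (hE x).fun_neg)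
        (by simp [hpq]) (by simp [hpq]) (hratio j)
        (fun y hy => mul_pos_of_neg_of_neg (neg_lt_zero.2 hA)
          (neg_of_mul_neg_left (key c hc j y hy) hw0.le))
        (fun y hy => mul_pos_of_neg_of_neg (neg_lt_zero.2 hA)
          (neg_of_mul_neg_left (key c' hc' j y hy) hw0.le))
      exact div_nonpos_of_nonpos_of_nonneg
        (div_nonpos_of_nonpos_of_nonneg (by simp at hst; linarith) hgap.le) hw0.le
  -- coefficients
  have hcard : ∀ l : Fin (M + 2), (Finset.univ.erase l).card = M + 1 := fun l => by
    simp [Finset.card_erase_of_mem]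
  open Polynomial in
  have hnat : ∀ l : Fin (M + 2), (∏ k ∈ Finset.univ.erase l, (X - C (c k))).natDegree = M + 1 :=
    fun l => by rw [natDegree_prod_of_monic _ _ (fun k _ => monic_X_sub_C _)]; simp
  open Polynomial in
  have hc1 : ∀ l : Fin (M + 2), (∏ k ∈ Finset.univ.erase l, (X - C (c k))).coeff (M + 1) = 1 :=
    fun l => by
      have := (monic_prod_X_sub_C c (Finset.univ.erase l)).coeff_natDegree
      rwa [hnat] at this
  open Polynomial in
  have hc0 : ∀ l : Fin (M + 2), (∏ k ∈ Finset.univ.erase l, (X - C (c k))).coeff M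
      = -(∑ k, c k - c l) := fun l => by
    have := prod_X_sub_C_coeff_card_pred (Finset.univ.erase l) c (by rw [hcard]; omega)
    rw [hcard] at this
    rw [show M + 1 - 1 = M by omega] at this
    rw [this, Finset.sum_erase_eq_sub (Finset.mem_univ l)]
  have hdeg : e.degree < (M + 1 : ℕ) := by
    rw [Polynomial.degree_lt_iff_coeff_zero]
    intro m hm
    rcases hm.eq_or_lt with rfl | hm
    · simp only [he, Polynomial.coeff_neg, Polynomial.finsetSum_coeff, Polynomial.coeff_C_mul, hc1]
      rw [← Finset.sum_mul, hsum]; simp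
    · simp only [he, Polynomial.coeff_neg, Polynomial.finsetSum_coeff, Polynomial.coeff_C_mul]
      rw [neg_eq_zero]
      apply Finset.sum_eq_zero
      intro l _
      rw [Polynomial.coeff_eq_zero_of_natDegree_lt (by rw [hnat]; exact hm)]
      simp
  have hlag := Lagrange.coeff_eq_sum (s := (Finset.univ : Finset (Fin (M + 1)))) (v := x)
    hxm.injective.injOn (P := e) (by simpa using hdeg)
  have hle : e.coeff M ≤ 0 := by
    have h0 : (Finset.univ : Finset (Fin (M + 1))).card - 1 = M := by simp
    rw [h0] at hlag
    rw [hlag]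
    exact Finset.sum_nonpos fun j _ => hterm j
  have hcoef : e.coeff M = -(A * ∑ i, (c' i - c i) * c i) := by
    simp only [he, Polynomial.coeff_neg, Polynomial.finsetSum_coeff, Polynomial.coeff_C_mul, hc0]
    congr 1
    have : ∑ l, (c' l - c l) * (A * -(∑ k, c k - c l))
        = -(A * ∑ k, c k) * ∑ l, (c' l - c l) + A * ∑ l, (c' l - c l) * c l := by
      generalize ∑ k, c k = S
      rw [Finset.mul_sum, Finset.mul_sum, ← Finset.sum_add_distrib]
      exact Finset.sum_congr rfl fun l _ => by ring
    rw [this, hsum]; ring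
  rw [hcoef] at hle
  by_contra hneg
  push Not at hneg
  have := mul_neg_of_pos_of_neg hA hneg
  linarith

theorem crit_eq {N : ℕ} (c c' : Fin N → ℝ) (hc : StrictMono c) (hc' : StrictMono c')
    (A : ℝ) (hA : 0 < A) (p q : ℝ → ℝ)
    (hp : ∀ x, HasDerivAt p (A * ∏ k, (x - c k)) x)
    (hq : ∀ x, HasDerivAt q (A * ∏ k, (x - c' k)) x)
    (hpq : ∀ i, p (c i) = q (c' i)) (hsum : ∑ i, (c' i - c i) = 0) : c = c' := by
  match N, c, c', hc, hc', hp, hq, hpq, hsum with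
  | 0, c, c', _, _, _, _, _, _ => exact Subsingleton.elim _ _
  | 1, c, c', _, _, _, _, _, hsum =>
    ext i
    fin_cases i
    simp at hsum ⊢
    linarith
  | M + 2, c, c', hc, hc', hp, hq, hpq, hsum =>
    have h1 := sum_nonneg_aux c c' hc hc' A hA p q hp hq hpq hsum
    have h2 := sum_nonneg_aux c' c hc' hc A hA q p hq hp (fun i => (hpq i).symm) (by
      rw [← neg_eq_zero, ← Finset.sum_neg_distrib, ← hsum]
      exact Finset.sum_congr rfl fun i _ => by ring)
    have h3 : ∑ i, (c' i - c i) ^ 2 = -(∑ i, (c' i - c i) * c i + ∑ i, (c i - c' i) * c' i) := by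
      rw [← Finset.sum_add_distrib, ← Finset.sum_neg_distrib]
      exact Finset.sum_congr rfl fun i _ => by ring
    have h4 : ∑ i, (c' i - c i) ^ 2 = 0 :=
      le_antisymm (by linarith) (Finset.sum_nonneg fun i _ => sq_nonneg _)
    rw [Finset.sum_eq_zero_iff_of_nonneg (fun i _ => sq_nonneg _)] at h4
    ext i
    have := pow_eq_zero_iff (two_ne_zero) |>.1 (h4 i (Finset.mem_univ i))
    linarith

/-- Factorization of the derivative. -/
theorem deriv_factor (n : ℕ) (hn : 2 ≤ n) (P : Polynomial ℝ) (hd : P.natDegree = n)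
    (cs : Fin (n - 1) → ℝ) (hmono : StrictMono cs)
    (hcrit : ∀ j, P.derivative.eval (cs j) = 0) (x : ℝ) :
    P.derivative.eval x = (n * P.leadingCoeff) * ∏ k, (x - cs k) := by
  have hP0 : P ≠ 0 := by rintro rfl; simp at hd; omega
  have hnd : P.derivative.natDegree = n - 1 := by
    rw [Polynomial.natDegree_derivative, hd]
  have hlead : P.derivative.leadingCoeff = n * P.leadingCoeff := by
    rw [Polynomial.leadingCoeff, hnd, Polynomial.coeff_derivative, show n - 1 + 1 = n by omega,
      Polynomial.leadingCoeff, hd, Nat.cast_sub (by omega)]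
    push_cast; ring
  have hne : P.derivative ≠ 0 := by
    intro h; rw [h] at hnd; simp at hnd; omega
  have hdg : P.derivative.degree = (n - 1 : ℕ) := by
    rw [Polynomial.degree_eq_natDegree hne, hnd]
  open Polynomial in
  have hfac : P.derivative = C (P.derivative.leadingCoeff) * ∏ k, (X - C (cs k)) := by
    have hl : P.derivative.leadingCoeff ≠ 0 := leadingCoeff_ne_zero.2 hne
    have hmon := monic_prod_X_sub_C cs Finset.univ
    have hdd : (∏ k, (X - C (cs k)) : ℝ[X]).degree = ((n - 1 : ℕ) : WithBot ℕ) := by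
      rw [degree_prod]; simp
    apply Polynomial.eq_of_degree_le_of_eval_index_eq (s := Finset.univ) (v := cs)
      hmono.injective.injOn
    · rw [hdg]; simp
    · rw [degree_C_mul hl, hdd, hdg]
    · rw [leadingCoeff_mul, hmon.leadingCoeff, leadingCoeff_C, mul_one]
    · intro i _
      rw [hcrit, eval_mul, eval_prod, Finset.prod_eq_zero (Finset.mem_univ i) (by simp)]
      simp
  rw [hfac, hlead]
  simp [Polynomial.eval_prod]

theorem same_critical_values_implies_affine_equivalent (n : ℕ) (hn : 2 ≤ n)
    (P₁ P₂ : Polynomial ℝ)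
    (hd₁ : P₁.natDegree = n) (hd₂ : P₂.natDegree = n)
    (hl₁ : 0 < P₁.leadingCoeff) (hl₂ : 0 < P₂.leadingCoeff)
    (cs cs' : Fin (n - 1) → ℝ) (hmono : StrictMono cs) (hmono' : StrictMono cs')
    (hcrit : ∀ j, P₁.derivative.eval (cs j) = 0)
    (hcrit' : ∀ j, P₂.derivative.eval (cs' j) = 0)
    (hall : ∀ x : ℝ, P₁.derivative.eval x = 0 → ∃ j, x = cs j)
    (hall' : ∀ x : ℝ, P₂.derivative.eval x = 0 → ∃ j, x = cs' j)
    (hvals : ∀ j, P₁.eval (cs j) = P₂.eval (cs' j)) :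
    ∃ c > (0 : ℝ), ∃ b : ℝ, ∀ z : ℝ, P₁.eval z = P₂.eval (c * z + b) := by
  have hn0 : n ≠ 0 := by omega
  have hcardpos : (0:ℝ) < ((n - 1 : ℕ) : ℝ) := by
    have : 0 < n - 1 := by omega
    exact_mod_cast this
  obtain ⟨κ, hκ, hκn⟩ : ∃ κ : ℝ, 0 < κ ∧ κ ^ n = P₁.leadingCoeff / P₂.leadingCoeff :=
    ⟨(P₁.leadingCoeff / P₂.leadingCoeff) ^ ((n : ℝ)⁻¹), Real.rpow_pos_of_pos (div_pos hl₁ hl₂) _,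
      Real.rpow_inv_natCast_pow (div_pos hl₁ hl₂).le hn0⟩
  set b : ℝ := (∑ i, cs' i - κ * ∑ i, cs i) / ((n - 1 : ℕ) : ℝ) with hb
  set d : Fin (n - 1) → ℝ := fun i => (cs' i - b) / κ with hdd
  have hd' : ∀ i, κ * d i + b = cs' i := fun i => by simp only [hdd]; field_simp; ring
  set A : ℝ := n * P₁.leadingCoeff with hA
  have hApos : 0 < A := mul_pos (by exact_mod_cast Nat.pos_of_ne_zero hn0) hl₁
  have hp : ∀ x, HasDerivAt (fun z => P₁.eval z) (A * ∏ k, (x - cs k)) x := fun x => by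
    rw [hA, ← deriv_factor n hn P₁ hd₁ cs hmono hcrit x]
    exact P₁.hasDerivAt x
  have hq : ∀ x, HasDerivAt (fun z => P₂.eval (κ * z + b)) (A * ∏ k, (x - d k)) x := fun x => by
    have h1 : HasDerivAt (fun z : ℝ => κ * z + b) κ x := by
      simpa using ((hasDerivAt_id x).const_mul κ).add_const b
    have h2 := (P₂.hasDerivAt (κ * x + b)).comp x h1
    rw [deriv_factor n hn P₂ hd₂ cs' hmono' hcrit'] at h2
    refine h2.congr_deriv (Eq.symm ?_)
    have h3 : ∀ k, κ * x + b - cs' k = κ * (x - d k) := fun k => by rw [← hd' k]; ring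
    simp_rw [h3]
    rw [Finset.prod_mul_distrib, Finset.prod_const, Finset.card_univ, Fintype.card_fin]
    have h4 : κ ^ (n - 1) * κ = P₁.leadingCoeff / P₂.leadingCoeff := by
      rw [← pow_succ, show n - 1 + 1 = n by omega, hκn]
    have h5 : P₁.leadingCoeff = P₂.leadingCoeff * (κ ^ (n - 1) * κ) := by
      rw [h4]; field_simp
    rw [hA, h5]; ring
  have hdm : StrictMono d := fun i j hij =>
    div_lt_div_of_pos_right (sub_lt_sub_right (hmono' hij) b) hκ
  have hsum : ∑ i, (d i - cs i) = 0 := by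
    rw [Finset.sum_sub_distrib]
    simp only [hdd]
    rw [← Finset.sum_div, Finset.sum_sub_distrib, Finset.sum_const, Finset.card_univ,
      Fintype.card_fin, nsmul_eq_mul, hb]
    field_simp
    ring
  have heq := crit_eq cs d hmono hdm A hApos _ _ hp hq (fun i => by
    rw [hd']; exact hvals i) hsum
  refine ⟨κ, hκ, b, fun z => ?_⟩
  have hconst : ∀ x y, P₁.eval x - P₂.eval (κ * x + b) = P₁.eval y - P₂.eval (κ * y + b) := by
    have hder : ∀ x, HasDerivAt (fun z => P₁.eval z - P₂.eval (κ * z + b)) 0 x := fun x => by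
      have := (hp x).fun_sub (hq x)
      rw [← heq, sub_self] at this
      exact this
    exact is_const_of_deriv_eq_zero (fun x => (hder x).differentiableAt) fun x => (hder x).deriv
  have i0 : Fin (n - 1) := ⟨0, by omega⟩
  have h := hconst z (cs i0)
  have h2 : κ * cs i0 + b = cs' i0 := by rw [heq]; exact hd' i0
  rw [h2, hvals i0, sub_self] at h
  linarith
end
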